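/- Let K be a function field over a finite field 𝔽_q of characteristic p, let E be an elliptic curve over K, and let ℓ be any prime number (ℓ = p is allowed). Then the quotient group E(K)/ℓE(K) is finite (the weak Mordell–Weil theorem for function fields). -/

import Mathlib

set_option linter.unusedSectionVars false
namespace WMW
open WeierstrassCurve Height MvPolynomial

section par
variable {K : Type*} [Field K] [DecidableEq K] (W : WeierstrassCurve K) [W.IsElliptic]

lemma addSub_vec (v : Fin 3 → K) : (fun i ↦ (addSubMap W i).eval v) =
   ![v 0 ^ 2 - W.b₄ * v 0 * v 2 - W.b₆ * v 1 * v 2 - W.b₈ * v 2 ^ 2,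
    2 * v 1 * v 0 + W.b₂ * v 0 * v 2 + W.b₄ * v 1 * v 2 + W.b₆ * v 2 ^ 2,
    v 1 ^ 2 - 4 * v 0 * v 2] := by
  ext i; fin_cases i <;> simp [addSubMap]

lemma par_dbl (P : W.toAffine.Point) :
    ∃ k : K, k ≠ 0 ∧ (fun i ↦ (addSubMap W i).eval (P.sym2x P)) = k • (P + P).sym2x 0 := by
  have hne := addSubMap_ne_zero W (P.sym2x_ne_zero P)
  rw [addSub_vec] at hne ⊢
  cases P with
  | zero => exact ⟨1, one_ne_zero, by simp [← Affine.Point.zero_def]⟩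
  | some x y h =>
    have e := (Affine.equation_iff ..).1 h.1
    by_cases hy : y = W.toAffine.negY x y
    · rw [Affine.Point.add_self_of_Y_eq hy]
      simp only [Affine.Point.sym2x_some_some, Affine.Point.sym2x_zero_zero] at hne ⊢
      simp only [Matrix.cons_val_zero, Matrix.cons_val_one, Matrix.cons_val] at hne ⊢
      have h1 : 2 * (x+x) * (x*x) + W.b₂ * (x*x) * 1 + W.b₄ * (x+x) * 1 + W.b₆ * 1 ^ 2 = 0 := by
        rw [Affine.negY] at hy
        simp only [b₂, b₄, b₆]
        linear_combination -4 * e + (2 * y + W.a₁ * x + W.a₃) * hy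
      have h2 : (x + x) ^ 2 - 4 * (x * x) * 1 = 0 := by ring
      rw [h1, h2] at hne ⊢
      generalize (x * x) ^ 2 - W.b₄ * (x * x) * 1 - W.b₆ * (x + x) * 1 - W.b₈ * 1 ^ 2 = k at hne ⊢
      refine ⟨k, fun h0 => hne ?_, ?_⟩
      · rw [h0]; ext i; fin_cases i <;> simp
      · ext i; fin_cases i <;> simp
    · rw [Affine.Point.add_self_of_Y_ne hy]
      have hy' : 2 * y + W.a₁ * x + W.a₃ ≠ 0 := by
        contrapose! hy; rw [Affine.negY]; linear_combination hy
      refine ⟨(2 * y + W.a₁ * x + W.a₃)^2, pow_ne_zero 2 hy', ?_⟩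
      simp only [Affine.Point.sym2x_some_some, Affine.Point.sym2x_some_zero]
      rw [Affine.slope_of_Y_ne rfl hy, Affine.addX, Affine.negY]
      have : y - (-y - W.a₁ * x - W.a₃) = 2 * y + W.a₁ * x + W.a₃ := by ring
      rw [this]
      generalize hm : (3 * x ^ 2 + 2 * W.toAffine.a₂ * x + W.toAffine.a₄ - W.toAffine.a₁ * y) / (2 * y + W.a₁ * x + W.a₃) = m
      rw [div_eq_iff hy'] at hm
      ext i; fin_cases i
      · simp [b₂, b₄, b₆, b₈]
        generalize W.toAffine.a₁ = a1 at *
        generalize W.toAffine.a₂ = a2 at *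
        generalize W.toAffine.a₃ = a3 at *
        generalize W.toAffine.a₄ = a4 at *
        generalize W.toAffine.a₆ = a6 at *
        clear hne hy'
        grind
      · simp [b₂, b₄, b₆, b₈]
        linear_combination -4 * e
      · simp; ring

theorem par_prop (P Q : W.toAffine.Point) :
    ∃ k : K, k ≠ 0 ∧ (fun i ↦ (addSubMap W i).eval (P.sym2x Q)) = k • (P + Q).sym2x (P - Q) := by
  by_cases hPQ : P = Q
  · subst hPQ; simpa using par_dbl W P
  by_cases hPQ' : P = -Q
  · obtain ⟨k, hk, h⟩ := par_dbl W P
    refine ⟨k, hk, ?_⟩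
    have : Q = -P := by rw [hPQ', neg_neg]
    subst this
    rw [Affine.Point.sym2x_neg_right, h, add_neg_cancel, sub_neg_eq_add, Affine.Point.sym2x_comm]
  match P, Q, hPQ, hPQ' with
  | 0, 0, h, _ => exact (h rfl).elim
  | 0, .some x y h, _, _ =>
    refine ⟨1, one_ne_zero, ?_⟩
    rw [addSub_vec]
    rw [zero_add, zero_sub, Affine.Point.sym2x_neg_right]
    simp only [Affine.Point.sym2x_zero_some, Affine.Point.sym2x_some_some]
    ext i; fin_cases i <;> simp <;> ring
  | .some x y h, 0, _, _ =>
    refine ⟨1, one_ne_zero, ?_⟩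
    rw [addSub_vec]
    rw [add_zero, sub_zero]
    simp only [Affine.Point.sym2x_some_zero, Affine.Point.sym2x_some_some]
    ext i; fin_cases i <;> simp <;> ring
  | .some x y h, .some x' y' h', n1, n2 =>
    have hx : x ≠ x' := by
      intro hx
      have := Affine.Point.eq_or_eq_neg_of_xRep_eq_xRep (P := .some x y h) (Q := .some x' y' h')
        (by simp [hx])
      tauto
    have e := (Affine.equation_iff ..).1 h.1
    have e' := (Affine.equation_iff ..).1 h'.1
    refine ⟨(x - x')^2, pow_ne_zero 2 (sub_ne_zero.2 hx), ?_⟩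
    rw [addSub_vec, sub_eq_add_neg (Affine.Point.some x y h), Affine.Point.neg_some, Affine.Point.add_of_X_ne hx,
      Affine.Point.add_of_X_ne hx]
    simp only [Affine.Point.sym2x_some_some, Affine.slope_of_X_ne hx, Affine.addX, Affine.negY]
    have hx' := sub_ne_zero.2 hx
    generalize hm : (y - y') / (x - x') = m
    generalize hn : (y - (-y' - W.toAffine.a₁ * x' - W.toAffine.a₃)) / (x - x') = n
    rw [div_eq_iff hx'] at hm hn
    generalize ha1 : W.toAffine.a₁ = a1 at *
    generalize ha2 : W.toAffine.a₂ = a2 at *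
    generalize ha3 : W.toAffine.a₃ = a3 at *
    generalize ha4 : W.toAffine.a₄ = a4 at *
    generalize ha6 : W.toAffine.a₆ = a6 at *
    clear n1 n2 hPQ hPQ'
    ext i; fin_cases i
    · simp [b₂, b₄, b₆, b₈, ha1, ha2, ha3, ha4, ha6]
      clear ha1 ha2 ha3 ha4 ha6 h h'
      have hy : y = y' + m * (x - x') := by rw [← hm]; ring
      have h4 : a4 = m * (y + y' + a3) + a1 * (y' + m * x) - (x^2 + x*x' + x'^2 + a2 * (x + x')) := by
        apply mul_left_cancel₀ hx'
        rw [hy] at e ⊢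
        linear_combination e' - e
      have h6 : a6 = y' ^ 2 + a1 * x' * y' + a3 * y' - (x' ^ 3 + a2 * x' ^ 2 + a4 * x') := by
        linear_combination -e'
      have h2 : (x - x')^2 * (n ^ 2 + a1 * n - a2 - x - x') = (y - (-y' - a1 * x' - a3))^2
         + a1 * (y - (-y' - a1 * x' - a3)) * (x - x') - (a2 + x + x') * (x - x')^2 := by
        rw [hn]; ring
      rw [mul_left_comm ((x - x')^2), h2]
      clear h2 hn hm e e' hx hx'
      rw [h6, h4, hy]
      ring
    · simp [b₂, b₄, b₆, b₈, ha1, ha2, ha3, ha4, ha6]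
      clear ha1 ha2 ha3 ha4 ha6 h h'
      grind
    · simp; ring

/-- height -/
noncomputable def hgt {K : Type*} [Field K] [AdmissibleAbsValues K] {W : WeierstrassCurve K}
    (P : W.toAffine.Point) : ℝ := logHeight P.xRep

variable [AdmissibleAbsValues K]

theorem parallelogram : ∃ C, ∀ P Q : W.toAffine.Point,
    |hgt (P + Q) + hgt (P - Q) - 2 * (hgt P + hgt Q)| ≤ C := by
  obtain ⟨C1, h1⟩ := abs_logHeight_addSubMap_sub_two_mul_logHeight_le W
  obtain ⟨C2, h2⟩ := abs_logHeight_sym2_sub_le K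
  have h2' (P Q : W.toAffine.Point) : |logHeight (P.sym2x Q) - (hgt P + hgt Q)| ≤ C2 := by
    have e (P : W.toAffine.Point) : ![P.xRep 0, P.xRep 1] = P.xRep := by
      ext i; fin_cases i <;> rfl
    have := h2 (a := P.xRep 0) (b := P.xRep 1) (c := Q.xRep 0) (d := Q.xRep 1)
      (by rw [e]; exact P.xRep_ne_zero) (by rw [e]; exact Q.xRep_ne_zero)
    rwa [e, e] at this
  refine ⟨C1 + 3 * C2, fun P Q => ?_⟩
  obtain ⟨k, hk, h⟩ := par_prop W P Q
  have a1 := h1 (P.sym2x Q)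
  rw [h, logHeight_smul_eq_logHeight _ hk] at a1
  have a2 := h2' P Q
  have a3 := h2' (P + Q) (P - Q)
  rw [abs_le] at *
  constructor <;> linarith

lemma hgt_nonneg (P : W.toAffine.Point) : 0 ≤ hgt P := logHeight_nonneg _

lemma northcott_hgt [Northcott (mulHeight₁ (K := K))] :
    Northcott (hgt : W.toAffine.Point → ℝ) := by
  refine ⟨fun b => ?_⟩
  have h1 : {x : K | logHeight₁ x ≤ b}.Finite := Northcott.finite_le b
  have h2 := (h1.image (fun x => ![x, 1])).union (Set.finite_singleton ![(1:K), 0])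
  refine (h2.preimage' (f := fun P : W.toAffine.Point => P.xRep) ?_).subset ?_
  · intro v hv
    by_cases h : ∃ Q : W.toAffine.Point, Q.xRep = v
    · obtain ⟨Q, rfl⟩ := h
      refine (Set.toFinite {Q, -Q}).subset ?_
      intro P hP
      exact Affine.Point.eq_or_eq_neg_of_xRep_eq_xRep hP
    · convert Set.finite_empty
      ext P
      simp
      exact fun h' => h ⟨P, h'⟩
  · intro P hP
    cases P with
    | zero => right; exact Affine.Point.xRep_zero
    | some x y h =>
      left
      refine ⟨x, ?_, rfl⟩
      simpa [hgt, logHeight₁_eq_logHeight] using hP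

theorem fg_two [Northcott (mulHeight₁ (K := K))]
    (H : (nsmulAddMonoidHom (α := W.toAffine.Point) 2).range.FiniteIndex) :
    AddGroup.FG W.toAffine.Point := by
  obtain ⟨C, hC⟩ := parallelogram W
  have := northcott_hgt W
  exact AddCommGroup.fg_of_descent' H (hgt_nonneg W) hC

theorem fg_three [Northcott (mulHeight₁ (K := K))]
    (H : (nsmulAddMonoidHom (α := W.toAffine.Point) 3).range.FiniteIndex) :
    AddGroup.FG W.toAffine.Point := by
  obtain ⟨C, hC⟩ := parallelogram W
  have := northcott_hgt W
  refine AddCommGroup.fg_of_descent (h := hgt) (a := 2) (b := 9) (c₀ := 3 * C + 2 * hgt (0 : W.toAffine.Point)) (c := fun g => 2 * hgt (-g) + C)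
    (by norm_num) (by norm_num) H ?_ ?_
  · intro g x
    have := hC (g + x) (-g)
    rw [abs_le] at this
    have h2 := hgt_nonneg W (g + x + g)
    rw [show g + x + -g = x by abel, sub_neg_eq_add] at this
    linarith
  · intro x
    have a1 := hC x x
    have a2 := hC (x + x) x
    rw [abs_le] at a1 a2
    rw [sub_self] at a1
    rw [add_sub_cancel_right] at a2
    rw [show 3 • x = x + x + x by abel]
    linarith
end par
end WMW

set_option linter.unusedSectionVars false
namespace WMW
open WeierstrassCurve

section vc
variable {K : Type*} [Field K] [DecidableEq K]

/-- `W'` is obtained from `W` by the substitution with parameters `u r s t`. -/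
structure VC (W W' : WeierstrassCurve K) (u r s t : K) : Prop where
  hu : u ≠ 0
  h1 : u * W'.a₁ = W.a₁ + 2 * s
  h2 : u ^ 2 * W'.a₂ = W.a₂ - s * W.a₁ + 3 * r - s ^ 2
  h3 : u ^ 3 * W'.a₃ = W.a₃ + r * W.a₁ + 2 * t
  h4 : u ^ 4 * W'.a₄ = W.a₄ - s * W.a₃ + 2 * r * W.a₂ - (t + r * s) * W.a₁ + 3 * r ^ 2 - 2 * s * t
  h6 : u ^ 6 * W'.a₆ = W.a₆ + r * W.a₄ + r ^ 2 * W.a₂ + r ^ 3 - t * W.a₃ - t ^ 2 - r * t * W.a₁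

lemma VC.of_smul (W : WeierstrassCurve K) (C : VariableChange K) :
    VC W (C • W) C.u C.r C.s C.t := by
  have hu : (C.u : K) ≠ 0 := C.u.ne_zero
  constructor
  · exact hu
  all_goals simp only [variableChange_def, Units.val_inv_eq_inv_val]; field_simp

variable {W W' : WeierstrassCurve K} {u r s t : K} (c : VC W W' u r s t)
include c

lemma VC.eqn (X Y : K) : W.toAffine.Equation (u ^ 2 * X + r) (u ^ 3 * Y + s * u ^ 2 * X + t) ↔
    W'.toAffine.Equation X Y := by
  rw [Affine.equation_iff, Affine.equation_iff]
  have hu := c.hu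
  rw [← mul_right_inj' (b := Y ^ 2 + W'.toAffine.a₁ * X * Y + W'.toAffine.a₃ * Y) (pow_ne_zero 6 hu)]
  rw [← sub_eq_zero, ← sub_eq_zero (a := u ^ 6 * _)]
  have : ∀ a b : K, a = b → (a = 0 ↔ b = 0) := by rintro a b rfl; rfl
  apply this
  linear_combination -u^5 * X * Y * c.h1 + u^4 * X^2 * c.h2 - u^3 * Y * c.h3 +u^2 * X * c.h4 + c.h6

variable [W.IsElliptic] [W'.IsElliptic]

/-- point map -/
def VC.toFun : W'.toAffine.Point → W.toAffine.Point
  | .zero => .zero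
  | .some X Y h => .some (u ^ 2 * X + r) (u ^ 3 * Y + s * u ^ 2 * X + t)
      (Affine.equation_iff_nonsingular.1 ((c.eqn X Y).2 h.1))

lemma VC.negY (X Y : K) : W.toAffine.negY (u ^ 2 * X + r) (u ^ 3 * Y + s * u ^ 2 * X + t) =
    u ^ 3 * W'.toAffine.negY X Y + s * u ^ 2 * X + t := by
  simp only [Affine.negY]
  linear_combination u^2 * X * c.h1 + c.h3

lemma VC.slope (X₁ Y₁ X₂ Y₂ : K) (h : ¬ (X₁ = X₂ ∧ Y₁ = W'.toAffine.negY X₂ Y₂)) (hh : X₁ = X₂ → Y₁ = Y₂) :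
    W.toAffine.slope (u ^ 2 * X₁ + r) (u ^ 2 * X₂ + r) (u ^ 3 * Y₁ + s * u ^ 2 * X₁ + t)
      (u ^ 3 * Y₂ + s * u ^ 2 * X₂ + t) = u * W'.toAffine.slope X₁ X₂ Y₁ Y₂ + s := by
  have hu := c.hu
  by_cases hx : X₁ = X₂
  · have hy : Y₁ ≠ W'.toAffine.negY X₂ Y₂ := fun hy => h ⟨hx, hy⟩
    obtain rfl := hh hx
    subst hx
    have hy2 : u ^ 3 * Y₁ + s * u ^ 2 * X₁ + t ≠ W.toAffine.negY (u ^ 2 * X₁ + r) (u ^ 3 * Y₁ + s * u ^ 2 * X₁ + t) := by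
      rw [c.negY]
      contrapose! hy
      exact mul_left_cancel₀ (pow_ne_zero 3 hu) (by linear_combination hy)
    rw [Affine.slope_of_Y_ne rfl hy, Affine.slope_of_Y_ne rfl hy2]
    have d2 := sub_ne_zero.2 hy2
    have d1 := sub_ne_zero.2 hy
    rw [div_eq_iff d2, add_mul, c.negY]
    have e : (u ^ 3 * Y₁ + s * u ^ 2 * X₁ + t) - (u ^ 3 * W'.toAffine.negY X₁ Y₁ + s * u ^ 2 * X₁ + t) =
      u^3 * (Y₁ - W'.toAffine.negY X₁ Y₁) := by ring
    rw [e]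
    field_simp
    rw [Affine.negY]
    linear_combination (exp := 1) -2 * u^2 * X₁ * c.h2 - c.h4 + (u^3*Y₁ - s * u^2 * X₁) * c.h1 -s * c.h3
  · have hx2 : u ^ 2 * X₁ + r ≠ u ^ 2 * X₂ + r := by
      contrapose! hx
      exact mul_left_cancel₀ (pow_ne_zero 2 hu) (by linear_combination hx)
    rw [Affine.slope_of_X_ne hx, Affine.slope_of_X_ne hx2]
    have d2 := sub_ne_zero.2 hx2
    have d1 := sub_ne_zero.2 hx
    rw [div_eq_iff d2]
    have e : (u ^ 2 * X₁ + r) - (u ^ 2 * X₂ + r) = u^2 * (X₁ - X₂) := by ring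
    rw [e]
    field_simp
    ring

/-- point hom -/
def VC.hom : W'.toAffine.Point →+ W.toAffine.Point where
  toFun := c.toFun
  map_zero' := rfl
  map_add' P Q := by
    have hu := c.hu
    match P, Q with
    | 0, Q => rw [zero_add]; exact (zero_add (c.toFun Q)).symm
    | .some X Y h, 0 => rw [add_zero]; exact (add_zero (c.toFun _)).symm
    | .some X Y h, .some X' Y' h' =>
      by_cases hh : X = X' ∧ Y = W'.toAffine.negY X' Y'
      · rw [Affine.Point.add_of_Y_eq hh.1 hh.2]
        symm
        simp only [VC.toFun]
        apply Affine.Point.add_of_Y_eq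
        · rw [hh.1]
        · rw [c.negY, hh.1, hh.2]
      · rw [Affine.Point.add_some hh]
        have hh2 : ¬ (u ^ 2 * X + r = u ^ 2 * X' + r ∧ (u ^ 3 * Y + s * u ^ 2 * X + t) =
          W.toAffine.negY (u ^ 2 * X' + r) (u ^ 3 * Y' + s * u ^ 2 * X' + t)) := by
          rintro ⟨a, b⟩
          have hX : X = X' := mul_left_cancel₀ (pow_ne_zero 2 hu) (by linear_combination a)
          refine hh ⟨hX, ?_⟩
          rw [c.negY, hX] at b
          exact mul_left_cancel₀ (pow_ne_zero 3 hu) (by linear_combination b)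
        simp only [VC.toFun]
        rw [Affine.Point.add_some hh2, Affine.Point.some.injEq, c.slope X Y X' Y' hh (fun hX =>
          Affine.Y_eq_of_Y_ne h.1 h'.1 hX (fun hy => hh ⟨hX, hy⟩))]
        simp only [Affine.addX, Affine.addY, Affine.negAddY, Affine.negY]
        generalize W'.toAffine.slope X X' Y Y' = m
        have hX : u ^ 2 * (m ^ 2 + W'.toAffine.a₁ * m - W'.toAffine.a₂ - X - X') + r =
          (u * m + s) ^ 2 + W.toAffine.a₁ * (u * m + s) - W.toAffine.a₂ - (u ^ 2 * X + r) - (u ^ 2 * X' + r) := by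
          linear_combination u * m * c.h1 - c.h2
        refine ⟨hX, ?_⟩
        rw [← hX]
        generalize (m ^ 2 + W'.toAffine.a₁ * m - W'.toAffine.a₂ - X - X') = z
        linear_combination -u^2*z * c.h1 - c.h3

lemma VC.hom_some (X Y : K) (h) : c.hom (.some X Y h) = .some (u ^ 2 * X + r) (u ^ 3 * Y + s * u ^ 2 * X + t)
      (Affine.equation_iff_nonsingular.1 ((c.eqn X Y).2 h.1)) := rfl

lemma VC.inj : Function.Injective c.hom := by
  have hu := c.hu
  rw [injective_iff_map_eq_zero]
  intro P hP
  cases P with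
  | zero => rfl
  | some X Y h => rw [c.hom_some] at hP; simp at hP

lemma VC.surj : Function.Surjective c.hom := by
  have hu := c.hu
  intro P
  cases P with
  | zero => exact ⟨0, rfl⟩
  | some x y h =>
    have e1 : u ^ 2 * ((x - r) / u^2) + r = x := by field_simp; ring
    have e2 : u ^ 3 * ((y - t - s * (x - r)) / u^3) + s * u ^ 2 * ((x - r) / u^2) + t = y := by field_simp; ring
    have := c.eqn ((x - r) / u^2) ((y - t - s * (x - r)) / u^3)
    rw [e1, e2] at this
    refine ⟨.some _ _ (Affine.equation_iff_nonsingular.1 (this.1 h.1)), ?_⟩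
    rw [c.hom_some, Affine.Point.some.injEq]
    exact ⟨e1, e2⟩

end vc
end WMW

set_option linter.unusedSectionVars false
set_option linter.style.haveILetI false
namespace WMW

theorem exists_ext_abs {F L : Type*} [Field F] [Field L] [Algebra F L] [FiniteDimensional F L]
    [Algebra.IsSeparable F L] (v : AbsoluteValue F ℝ) (hna : IsNonarchimedean v)
    (hnt : v.IsNontrivial) :
    ∃ s : Multiset (AbsoluteValue L ℝ), ∀ x, (s.map (· x)).prod = v (Algebra.norm F x) := by
  classical
  letI : NontriviallyNormedField v.Completion :=
    { (inferInstance : NormedField v.Completion) with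
      non_trivial := by
        obtain ⟨x, hx⟩ := hnt.exists_abv_gt_one
        refine ⟨((WithAbs.toAbs v x : WithAbs v) : v.Completion), ?_⟩
        rw [UniformSpace.Completion.norm_coe]
        exact hx }
  haveI : IsUltrametricDist (WithAbs v) := by
    refine IsUltrametricDist.isUltrametricDist_of_forall_norm_add_le_max_norm ?_
    intro x y
    exact hna x.ofAbs y.ofAbs
  haveI : IsUltrametricDist v.Completion := by
    refine IsUltrametricDist.isUltrametricDist_of_forall_norm_add_le_max_norm ?_
    intro x y
    refine UniformSpace.Completion.induction_on₂ x y ?_ ?_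
    · exact isClosed_le (by fun_prop) (by fun_prop)
    · intro a b
      rw [← UniformSpace.Completion.coe_add]
      simp only [UniformSpace.Completion.norm_coe]
      exact hna a.ofAbs b.ofAbs
  let f : F →+* v.Completion :=
    (UniformSpace.Completion.coeRingHom (α := WithAbs v)).comp (WithAbs.equiv v).symm.toRingHom
  have hf : ∀ x, ‖f x‖ = v x := fun x => by
    show ‖((WithAbs.toAbs v x : WithAbs v) : v.Completion)‖ = v x
    rw [UniformSpace.Completion.norm_coe]; rfl
  let Ω := AlgebraicClosure v.Completion
  letI : Algebra F Ω := ((algebraMap v.Completion Ω).comp f).toAlgebra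
  let n : MulAlgebraNorm v.Completion Ω := spectralMulAlgNorm v.Completion Ω
  let w : (L →ₐ[F] Ω) → AbsoluteValue L ℝ := fun σ =>
    { toFun := fun x => n (σ x)
      map_mul' := fun x y => by simp [map_mul]
      nonneg' := fun x => apply_nonneg n _
      eq_zero' := fun x => by simp [map_eq_zero_iff_eq_zero]
      add_le' := fun x y => by simpa using map_add_le_add n (σ x) (σ y) }
  refine ⟨(Finset.univ : Finset (L →ₐ[F] Ω)).val.map w, fun x => ?_⟩
  rw [Multiset.map_map]
  show ∏ σ : (L →ₐ[F] Ω), n (σ x) = _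
  rw [← map_prod, ← Algebra.norm_eq_prod_embeddings F Ω x]
  show spectralNorm _ _ (algebraMap v.Completion Ω (f _)) = _
  rw [spectralNorm_extends, hf]

end WMW

set_option linter.unusedSectionVars false
set_option linter.style.haveILetI false
namespace WMW
open IsDedekindDomain HeightOneSpectrum Height Submodule

section ded
variable (R L : Type*) [CommRing R] [IsDedekindDomain R] [Infinite R] [Ring.HasFiniteQuotients R]
  [Field L] [Algebra R L] [IsFractionRing R L]

/-- cardinality of quotient, as a hom -/
noncomputable def cq : Ideal R →*₀ ℕ where
  toFun := Submodule.cardQuot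
  map_mul' I J := by
    exact UniqueFactorizationMonoid.multiplicative_of_coprime cardQuot I J (cardQuot_bot _ _)
      (fun {I J} hI => by simp [Ideal.isUnit_iff.mp hI, Ideal.mul_top])
      (fun {I} i hI =>
        have : Ideal.IsPrime I := Ideal.isPrime_of_prime hI
        cardQuot_pow_of_prime hI.ne_zero)
      fun {I J} hIJ => cardQuot_mul_of_coprime <| Ideal.isCoprime_iff_sup_eq.mpr
        (Ideal.isUnit_iff.mp
          (hIJ (Ideal.dvd_iff_le.mpr le_sup_left) (Ideal.dvd_iff_le.mpr le_sup_right)))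
  map_one' := by rw [Ideal.one_eq_top, cardQuot_top]
  map_zero' := by rw [Ideal.zero_eq_bot, cardQuot_bot]

lemma toNN_exp {e : NNReal} (he : e ≠ 0) (n : ℤ) :
    WithZeroMulInt.toNNReal he (WithZero.exp n) = e ^ n := by
  rw [WithZeroMulInt.toNNReal_neg_apply he (WithZero.exp_ne_zero)]
  rfl

variable {R}
lemma one_lt_cq (v : HeightOneSpectrum R) : 1 < cq R v.asIdeal := by
  haveI := Ring.HasFiniteQuotients.finiteQuotient v.ne_bot
  haveI : Nontrivial (R ⧸ v.asIdeal) := Ideal.Quotient.nontrivial_iff.mpr v.isPrime.ne_top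
  exact Finite.one_lt_card (α := R ⧸ v.asIdeal)

lemma one_lt_cq' (v : HeightOneSpectrum R) : 1 < (cq R v.asIdeal : NNReal) := by
  exact_mod_cast one_lt_cq v

/-- normalized abs value -/
noncomputable def av (v : HeightOneSpectrum R) : AbsoluteValue L ℝ := v.adicAbv (one_lt_cq' v)

lemma av_def (v : HeightOneSpectrum R) (x : L) : av L v x =
  WithZeroMulInt.toNNReal (ne_zero_of_lt (one_lt_cq' v)) (v.valuation L x) := rfl

lemma av_le_iff (v : HeightOneSpectrum R) (x y : L) :
    av L v x ≤ av L v y ↔ v.valuation L x ≤ v.valuation L y := by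
  rw [av_def, av_def, NNReal.coe_le_coe]
  exact (WithZeroMulInt.toNNReal_strictMono (one_lt_cq' v)).le_iff_le

lemma av_mul_cq (v : HeightOneSpectrum R) {x : R} (hx : x ≠ 0) :
    av L v (algebraMap R L x) * cq R (v.maxPowDividing (Ideal.span {x})) = 1 := by
  rw [maxPowDividing, map_pow, Nat.cast_pow, av_def, valuation_of_algebraMap,
    intValuation_if_neg _ hx, toNN_exp]
  have : (cq R v.asIdeal : ℝ) ≠ 0 := by have := one_lt_cq v; positivity
  push_cast
  rw [zpow_neg, zpow_natCast, inv_mul_cancel₀ (pow_ne_zero _ this)]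

lemma av_fin_int {x : R} (hx : x ≠ 0) :
    (fun v : HeightOneSpectrum R => av L v (algebraMap R L x)).HasFiniteMulSupport := by
  have h : Ideal.span {x} ≠ 0 := by simp [hx]
  refine (Ideal.finite_factors h).subset ?_
  intro v hv
  simp only [Function.mem_mulSupport] at hv
  rw [Set.mem_ofPred_eq, Ideal.dvd_span_singleton]
  by_contra hc
  exact hv ((v.adicAbv_coe_eq_one_iff (one_lt_cq' v) x).2 hc)

lemma prod_av_int {x : R} (hx : x ≠ 0) :
    (∏ᶠ v : HeightOneSpectrum R, av L v (algebraMap R L x)) * (cq R (Ideal.span {x})) = 1 := by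
  have h : Ideal.span {x} ≠ 0 := by simp [hx]
  conv_lhs => rw [← Ideal.finprod_heightOneSpectrum_factorization h]
  have h_prod : (cq R (∏ᶠ v : HeightOneSpectrum R, v.maxPowDividing (Ideal.span {x})) : ℝ) =
      ∏ᶠ v : HeightOneSpectrum R, (cq R (v.maxPowDividing (Ideal.span {x})) : ℝ) :=
    ((Nat.castRingHom ℝ).toMonoidHom.comp (cq R).toMonoidHom).map_finprod
      (Ideal.hasFiniteMulSupport h)
  rw [h_prod, ← finprod_mul_distrib (av_fin_int L hx)]
  · exact finprod_eq_one_of_forall_eq_one fun v ↦ av_mul_cq L v hx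
  · refine (Ideal.hasFiniteMulSupport h).subset ?_
    intro v hv hc
    rw [Function.mem_mulSupport] at hv
    exact hv (by simp only [hc, map_one, Nat.cast_one])

lemma av_fin {x : L} (hx : x ≠ 0) :
    (fun v : HeightOneSpectrum R => av L v x).HasFiniteMulSupport := by
  obtain ⟨a, b, hb, rfl⟩ := IsFractionRing.div_surjective R x
  have hb := nonZeroDivisors.ne_zero hb
  have ha : a ≠ 0 := by rintro rfl; simp at hx
  simp_rw [map_div₀]
  exact (av_fin_int L ha).div (av_fin_int L hb)

variable {L}
lemma av_inj : Function.Injective (av (R := R) L) := by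
  intro v w h
  ext r
  rw [← v.adicAbv_coe_lt_one_iff (K := L) (one_lt_cq' v), ← w.adicAbv_coe_lt_one_iff (K := L) (one_lt_cq' w)]
  show av L v _ < 1 ↔ av L w _ < 1
  rw [h]

/-- admissible absolute values -/
@[reducible]
noncomputable def adm (s : Multiset (AbsoluteValue L ℝ))
    (hs : ∀ r : R, r ≠ 0 → (s.map (· (algebraMap R L r))).prod = cq R (Ideal.span {r})) :
    AdmissibleAbsValues L where
  archAbsVal := s
  nonarchAbsVal := Set.range (av (R := R) L)
  isNonarchimedean := by
    rintro _ ⟨v, rfl⟩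
    exact isNonarchimedean_adicAbv v _
  hasFiniteMulSupport {x} hx := by
    have := av_fin (R := R) L hx
    refine (this.image (Set.rangeFactorization (av (R := R) L))).subset ?_
    rintro ⟨_, v, rfl⟩ hv
    exact ⟨v, hv, rfl⟩
  product_formula {x} hx := by
    have h1 : ∀ y : L, ∏ᶠ v : Set.range (av (R := R) L), v.val y =
        ∏ᶠ v : HeightOneSpectrum R, av L v y := fun y =>
      (finprod_comp_equiv (Equiv.ofInjective _ (av_inj (R := R) (L := L)))
        (f := fun v : Set.range (av (R := R) L) => v.val y)).symm
    rw [h1]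
    obtain ⟨a, b, hb, rfl⟩ := IsFractionRing.div_surjective R x
    have hb := nonZeroDivisors.ne_zero hb
    have ha : a ≠ 0 := by rintro rfl; simp at hx
    have e1 := prod_av_int L ha
    have e2 := prod_av_int L hb
    rw [← hs a ha] at e1
    rw [← hs b hb] at e2
    simp_rw [map_div₀]
    rw [finprod_div_distrib (av_fin_int L ha) (av_fin_int L hb), Multiset.prod_map_div]
    rw [div_mul_div_comm, mul_comm, e1, mul_comm, e2, div_one]

section north
variable (s : Multiset (AbsoluteValue L ℝ))
    (hs : ∀ r : R, r ≠ 0 → (s.map (· (algebraMap R L r))).prod = cq R (Ideal.span {r}))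

lemma av_le_height (v : HeightOneSpectrum R) (x : L) :
    letI := adm s hs
    av L v x ≤ mulHeight₁ x := by
  letI := adm s hs
  rw [mulHeight₁_eq]
  rcases eq_or_ne x 0 with rfl | hx
  · simp
  have h1 : 1 ≤ (AdmissibleAbsValues.archAbsVal.map fun v : AbsoluteValue L ℝ ↦ max (v x) 1).prod :=
    Multiset.one_le_prod_map fun _ _ ↦ le_max_right ..
  let w : AdmissibleAbsValues.nonarchAbsVal (K := L) := ⟨av L v, v, rfl⟩
  have h2 : max (w.val x) 1 ≤ ∏ᶠ v : AdmissibleAbsValues.nonarchAbsVal (K := L), max (v.val x) 1 := by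
    have hf : (fun v : AdmissibleAbsValues.nonarchAbsVal (K := L) => max (v.val x) 1).HasFiniteMulSupport := by
      refine (AdmissibleAbsValues.hasFiniteMulSupport hx).subset ?_
      intro v hv hc
      exact hv (by simp [hc])
    classical
    have e : max (w.val x) 1 = ∏ᶠ v : AdmissibleAbsValues.nonarchAbsVal (K := L),
        (if v = w then max (v.val x) 1 else 1) := by
      rw [finprod_eq_single _ w (fun v hv => by simp [hv])]
      simp
    rw [e]
    refine finprod_le_finprod ?_ (fun v => ?_) hf (fun v => ?_)
    · refine hf.subset ?_
      intro v hv hc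
      exact hv (by simp only [hc, ite_self])
    · show (0:ℝ) ≤ ite _ _ _
      split_ifs <;> positivity
    · show ite _ _ _ ≤ _
      split_ifs
      · exact le_rfl
      · exact le_max_right _ _
  calc av L v x = w.val x := rfl
    _ ≤ max (w.val x) 1 := le_max_left _ _
    _ ≤ _ := h2
    _ ≤ _ := le_mul_of_one_le_left (le_trans (by positivity) h2) h1

lemma northcott (v : HeightOneSpectrum R) :
    letI := adm s hs
    Northcott (mulHeight₁ (K := L)) := by
  letI := adm s hs
  constructor
  intro B
  have key : {x : L | mulHeight₁ x ≤ B ∧ v.valuation L x ≤ 1}.Finite := by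
    obtain ⟨m, hm⟩ := pow_unbounded_of_one_lt (2 ^ totalWeight L * B * B)
      (by exact_mod_cast one_lt_cq v : (1:ℝ) < (cq R v.asIdeal : ℝ))
    haveI := Ring.HasFiniteQuotients.finiteQuotient (pow_ne_zero m v.ne_bot : v.asIdeal ^ m ≠ 0)
    have ex : ∀ x : L, v.valuation L x ≤ 1 → ∃ a : R, v.valuation L (algebraMap R L a - x) ≤ WithZero.exp (-(m:ℤ)) := by
      intro x hx
      obtain ⟨a, ha⟩ := exists_valuation_sub_lt_of_integer (K := L) v hx (γ := Units.mk0 (WithZero.exp (-(m:ℤ))) (by simp))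
      exact ⟨a, ha.le⟩
    choose! f hf using ex
    refine Set.Finite.of_injOn (f := fun x => Ideal.Quotient.mk (v.asIdeal ^ m) (f x)) (t := Set.univ) (fun _ _ => trivial) ?_ Set.finite_univ
    rintro x ⟨hx, hx1⟩ y ⟨hy, hy1⟩ hxy
    by_contra hne
    have h0 : x - y ≠ 0 := sub_ne_zero.2 hne
    have h1 : v.valuation L (x - y) ≤ WithZero.exp (-(m:ℤ)) := by
      have : x - y = (algebraMap R L (f x - f y)) - (algebraMap R L (f x) - x) + (algebraMap R L (f y) - y) := by
        rw [map_sub]; ring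
      rw [this]
      refine (Valuation.map_add _ _ _).trans (max_le ((Valuation.map_sub _ _ _).trans (max_le ?_ (hf x hx1))) (hf y hy1))
      rw [valuation_of_algebraMap, intValuation_le_pow_iff_mem]
      exact Ideal.Quotient.eq.1 hxy
    have h2 := av_le_height s hs v (x - y)⁻¹
    rw [mulHeight₁_inv] at h2
    have h3 := h2.trans (mulHeight₁_sub_le x y)
    have h4 : (cq R v.asIdeal : ℝ) ^ m ≤ av L v (x-y)⁻¹ := by
      rw [map_inv₀, le_inv_comm₀ (by have := one_lt_cq v; positivity) ((av L v).pos h0)]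
      have := (WithZeroMulInt.toNNReal_strictMono (one_lt_cq' v)).monotone h1
      rw [av_def]
      refine (NNReal.coe_le_coe.2 this).trans ?_
      rw [toNN_exp]
      simp
    have h5 : 2 ^ totalWeight L * mulHeight₁ x * mulHeight₁ y ≤ 2 ^ totalWeight L * B * B := by
      have := mulHeight₁_nonneg x
      have := mulHeight₁_nonneg y
      have hB : 0 ≤ B := by linarith
      gcongr
    have hm' : 2 ^ totalWeight L * B * B < (cq R v.asIdeal : ℝ) ^ m := hm
    linarith
  refine (key.union (key.image (·⁻¹))).subset ?_
  intro x hx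
  by_cases h : v.valuation L x ≤ 1
  · exact Or.inl ⟨hx, h⟩
  · refine Or.inr ⟨x⁻¹, ⟨?_, ?_⟩, inv_inv x⟩
    · rw [mulHeight₁_inv]; exact hx
    · rw [map_inv₀]
      exact inv_le_one_of_one_le₀ (not_le.1 h).le
end north
end ded
end WMW

set_option linter.unusedSectionVars false
set_option linter.style.haveILetI false
namespace WMW
open IsDedekindDomain HeightOneSpectrum Height Submodule FractionalIdeal
open scoped nonZeroDivisors

lemma relIndex_of_map {G T : Type*} [CommGroup G] [Finite T] (A B : Subgroup G) (f : G → T)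
    (h : ∀ x ∈ A, ∀ y ∈ A, f x = f y → x / y ∈ B) : B.relIndex A ≠ 0 := by
  rw [Subgroup.relIndex]
  have : Finite (A ⧸ B.subgroupOf A) := by
    refine Finite.of_injective (fun q : A ⧸ B.subgroupOf A => f (q.out : A)) ?_
    intro p q hpq
    have := h _ q.out.2 _ p.out.2 hpq.symm
    rw [← QuotientGroup.out_eq' p, ← QuotientGroup.out_eq' q, QuotientGroup.eq]
    rw [Subgroup.mem_subgroupOf]
    simpa [div_eq_inv_mul] using this
  exact Nat.card_ne_zero.2 ⟨inferInstance, this⟩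

lemma map_of_relIndex {G : Type*} [CommGroup G] (A B : Subgroup G) (h : B.relIndex A ≠ 0) :
    ∃ (n : ℕ) (f : G → Fin n), ∀ x ∈ A, ∀ y ∈ A, f x = f y → x / y ∈ B := by
  classical
  haveI : Finite (A ⧸ B.subgroupOf A) := Nat.finite_of_card_ne_zero h
  obtain ⟨n, ⟨e⟩⟩ := Finite.exists_equiv_fin (A ⧸ B.subgroupOf A)
  refine ⟨n, fun x => if hx : x ∈ A then e (QuotientGroup.mk ⟨x, hx⟩) else e (QuotientGroup.mk 1), ?_⟩
  intro x hx y hy hxy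
  simp only [hx, hy, dif_pos] at hxy
  have := QuotientGroup.eq.1 (e.injective hxy).symm
  rw [Subgroup.mem_subgroupOf] at this
  simpa [div_eq_inv_mul] using this

lemma prod_max_le {L : Type*} [Field L] (s : Multiset (AbsoluteValue L ℝ)) (x : L) (C : ℝ)
    (hC : 1 ≤ C) (h : ∀ w ∈ s, w x ≤ C) :
    (s.map fun v : AbsoluteValue L ℝ ↦ max (v x) 1).prod ≤ C ^ s.card := by
  induction s using Multiset.induction_on with
  | empty => simp
  | cons a s ih =>
    rw [Multiset.map_cons, Multiset.prod_cons, Multiset.card_cons, pow_succ']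
    have := ih (fun w hw => h w (Multiset.mem_cons_of_mem hw))
    have h1 := h a (Multiset.mem_cons_self a s)
    refine mul_le_mul (max_le h1 hC) this ?_ (by positivity)
    exact Multiset.prod_nonneg (by simp only [Multiset.mem_map]; rintro _ ⟨w, _, rfl⟩; positivity)

section ded
variable (R L : Type*) [CommRing R] [IsDedekindDomain R] [Infinite R] [Ring.HasFiniteQuotients R]
  [Field L] [Algebra R L] [IsFractionRing R L]

/-- Selmer condition -/
def Sel (S : Set (HeightOneSpectrum R)) (m : ℕ) : Subgroup Lˣ where
  carrier := {x | ∀ v : HeightOneSpectrum R, v ∉ S → (m:ℤ) ∣ Multiplicative.toAdd (v.valuationOfNeZero (K := L) x)}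
  one_mem' := by intro v _; simp
  mul_mem' := by
    intro x y hx hy v hv
    rw [map_mul, toAdd_mul]
    exact dvd_add (hx v hv) (hy v hv)
  inv_mem' := by
    intro x hx v hv
    rw [map_inv, toAdd_inv, dvd_neg]
    exact hx v hv

variable {R L}
lemma sel_step1 (S : Set (HeightOneSpectrum R)) (hS : S.Finite) (m : ℕ) (hm : m ≠ 0) :
    (Sel R L ∅ m).relIndex (Sel R L S m) ≠ 0 := by
  haveI := hS.to_subtype
  haveI : NeZero m := ⟨hm⟩
  refine relIndex_of_map (T := S → ZMod m) _ _
    (fun x v => ((Multiplicative.toAdd (v.1.valuationOfNeZero (K := L) x) : ℤ) : ZMod m)) ?_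
  intro x hx y hy hxy v _
  rw [map_div, toAdd_div]
  by_cases hv : v ∈ S
  · have := congrFun hxy ⟨v, hv⟩
    simp only at this
    rw [← ZMod.intCast_zmod_eq_zero_iff_dvd]
    · push_cast
      rw [this, sub_self]
  · exact dvd_sub (hx v hv) (hy v hv)

lemma val_fin (x : Lˣ) : {v : HeightOneSpectrum R | v.valuationOfNeZero (K := L) x ≠ 1}.Finite := by
  refine (av_fin (R := R) L x.ne_zero).subset ?_
  intro v hv hc
  apply hv
  rw [← WithZero.coe_inj, valuationOfNeZero_eq]
  have : av L v (x : L) = 1 := hc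
  rw [av_def] at this
  exact (WithZeroMulInt.toNNReal_eq_one_iff _ _ (one_lt_cq' v).ne').1 (by exact_mod_cast this)

lemma span_eq (x : Lˣ) : spanSingleton R⁰ (x : L) = ∏ᶠ v : HeightOneSpectrum R,
    (v.asIdeal : FractionalIdeal R⁰ L) ^ (- Multiplicative.toAdd (v.valuationOfNeZero (K := L) x)) := by
  classical
  have h := IsLocalization.mk'_sec (M := R⁰) L (x : L)
  have hn : (IsLocalization.sec R⁰ (x : L)).1 ≠ 0 := by
    intro h0
    rw [h0, IsLocalization.mk'_zero] at h
    exact x.ne_zero h.symm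
  rw [← h, ← finprod_heightOneSpectrum_factorization_principal_fraction (K := L) hn]
  refine finprod_congr fun v => ?_
  congr 1
  show _ = -(Multiplicative.toAdd (v.valuationOfNeZeroToFun x))
  rw [valuationOfNeZeroToFun]
  simp only [toAdd_ofAdd, neg_sub]
  ring

lemma exists_root (m : ℕ) (hm : m ≠ 0) (x : Lˣ) (hx : x ∈ Sel R L ∅ m) :
    ∃ I : (FractionalIdeal R⁰ L)ˣ, I ^ m = toPrincipalIdeal R L x := by
  have : ∃ J : FractionalIdeal R⁰ L, J ^ m = spanSingleton R⁰ (x : L) := by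
    choose k hk using fun v => hx v (Set.notMem_empty v)
    refine ⟨∏ᶠ v : HeightOneSpectrum R, (v.asIdeal : FractionalIdeal R⁰ L) ^ (- k v), ?_⟩
    rw [span_eq, finprod_pow]
    · refine finprod_congr fun v => ?_
      rw [hk, ← zpow_natCast, ← zpow_mul]
      congr 1; ring
    · refine (val_fin x).subset ?_
      intro v hv hc
      apply hv
      have : k v = 0 := by
        have := hk v
        rw [hc, toAdd_one] at this
        have := mul_eq_zero.1 this.symm
        simpa [hm] using this
      simp [this]
  obtain ⟨J, hJ⟩ := this
  have hJ0 : J ≠ 0 := by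
    rintro rfl
    rw [zero_pow hm] at hJ
    exact x.ne_zero (spanSingleton_eq_zero_iff.1 hJ.symm)
  refine ⟨Units.mk0 J hJ0, ?_⟩
  rw [eq_comm, toPrincipalIdeal_eq_iff, ← hJ]
  simp

/-- units -/
abbrev UU (R L : Type*) [CommRing R] [Field L] [Algebra R L] : Subgroup Lˣ :=
  (Units.map (algebraMap R L : R →* L)).range

lemma mem_UU_of_principal {x : Lˣ} (h : toPrincipalIdeal R L x = 1) : x ∈ UU R L := by
  have key : ∀ y : Lˣ, toPrincipalIdeal R L y = 1 → ∃ r : R, algebraMap R L r = y := by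
    intro y hy
    rw [toPrincipalIdeal_eq_iff] at hy
    have : (y : L) ∈ (1 : FractionalIdeal R⁰ L) := by
      rw [← Units.val_one, ← hy]; exact mem_spanSingleton_self _ _
    exact (mem_one_iff _).1 this
  obtain ⟨r, hr⟩ := key x h
  obtain ⟨t, ht⟩ := key x⁻¹ (by rw [map_inv, h, inv_one])
  have hrt : r * t = 1 := by
    apply IsFractionRing.injective R L
    rw [map_mul, hr, ht, map_one, Units.mul_inv]
  refine ⟨⟨r, t, hrt, by rw [mul_comm, hrt]⟩, ?_⟩
  ext
  exact hr

lemma sel_step2 [Finite (ClassGroup R)] (m : ℕ) (hm : m ≠ 0) :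
    (UU R L ⊔ (powMonoidHom m : Lˣ →* Lˣ).range).relIndex (Sel R L ∅ m) ≠ 0 := by
  classical
  haveI : Finite ((FractionalIdeal R⁰ L)ˣ ⧸ (toPrincipalIdeal R L).range) :=
    Finite.of_equiv _ (ClassGroup.equiv (R := R) L).toEquiv
  choose! I hI using exists_root (R := R) (L := L) m hm
  refine relIndex_of_map (T := (FractionalIdeal R⁰ L)ˣ ⧸ (toPrincipalIdeal R L).range) _ _
    (fun x => QuotientGroup.mk (I x)) ?_
  intro x hx y hy hxy
  obtain ⟨z, hz⟩ := QuotientGroup.eq.1 hxy.symm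
  have h1 : toPrincipalIdeal R L (x / y / z ^ m) = 1 := by
    rw [map_div, map_div, map_pow, ← hI x hx, ← hI y hy, hz, mul_pow, inv_pow, mul_comm, ← div_eq_mul_inv, div_self']
  have := mem_UU_of_principal h1
  have e : x / y = (x / y / z ^ m) * z ^ m := by simp
  rw [e]
  exact mul_mem (Subgroup.mem_sup_left this) (Subgroup.mem_sup_right ⟨z, rfl⟩)

section units
variable (s : Multiset (AbsoluteValue L ℝ))
    (hs : ∀ r : R, r ≠ 0 → (s.map (· (algebraMap R L r))).prod = cq R (Ideal.span {r}))

lemma height_unit_le (u : Rˣ) (C : ℝ) (hC : 1 ≤ C) (h : ∀ w ∈ s, w (algebraMap R L u) ≤ C) :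
    letI := adm s hs
    mulHeight₁ (algebraMap R L u) ≤ C ^ s.card := by
  letI := adm s hs
  rw [mulHeight₁_eq]
  have h2 : ∏ᶠ v : AdmissibleAbsValues.nonarchAbsVal (K := L), max (v.val (algebraMap R L u)) 1 = 1 := by
    refine finprod_eq_one_of_forall_eq_one ?_
    rintro ⟨_, v, rfl⟩
    exact max_eq_right (v.adicAbv_coe_le_one _ _)
  rw [h2, mul_one]
  show (s.map fun v : AbsoluteValue L ℝ ↦ max (v (algebraMap R L u)) 1).prod ≤ _
  exact prod_max_le s _ C hC h

include hs in
lemma units_fin (v : HeightOneSpectrum R) (C : ℝ) :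
    {u : Rˣ | ∀ w ∈ s, w (algebraMap R L u) ≤ C}.Finite := by
  letI := adm s hs
  have := northcott s hs v
  have h1 := this.finite_le ((max C 1) ^ s.card)
  refine Set.Finite.of_injOn (f := fun u : Rˣ => algebraMap R L u) (t := _) ?_ ?_ h1
  · intro u hu
    exact height_unit_le s hs u (max C 1) (le_max_right _ _) (fun w hw => (hu w hw).trans (le_max_left _ _))
  · intro u _ u' _ h
    exact Units.ext (IsFractionRing.injective R L h)

/-- log map -/
noncomputable def logmap : Additive Rˣ →+ ({w // w ∈ s} → ℝ) where
  toFun u w := Real.log (w.1 (algebraMap R L (u.toMul : R)))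
  map_zero' := by ext w; simp
  map_add' x y := by
    ext w
    have h : ∀ x : Rˣ, w.1 (algebraMap R L x) ≠ 0 := fun x => by
      simp [w.1.ne_zero_iff]
    simp only [toMul_add, Units.val_mul, map_mul, Pi.add_apply]
    exact Real.log_mul (h _) (h _)

include hs in
lemma units_fg (v : HeightOneSpectrum R) : AddGroup.FG (Additive Rˣ) := by
  classical
  haveI : Finite {w // w ∈ s} := (Multiset.finite_toSet s).to_subtype
  haveI : Fintype {w // w ∈ s} := Fintype.ofFinite _
  let f : Additive Rˣ →ₗ[ℤ] ({w // w ∈ s} → ℝ) := (logmap (R := R) s).toIntLinearMap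
  have hfin : ∀ C : ℝ, {u : Additive Rˣ | ‖f u‖ ≤ C}.Finite := by
    intro C
    refine Set.Finite.of_injOn (f := fun u : Additive Rˣ => u.toMul) (t := _) ?_
      (fun _ _ _ _ h => h) (units_fin s hs v (Real.exp C))
    intro u hu w hw
    have h1 : ‖f u ⟨w, hw⟩‖ ≤ C := (norm_le_pi_norm (f u) ⟨w, hw⟩).trans hu
    have h2 : Real.log (w (algebraMap R L (u.toMul : R))) ≤ C := (le_abs_self _).trans h1
    refine (Real.log_le_iff_le_exp ?_).1 h2
    exact w.pos (by simp)
  haveI : DiscreteTopology (LinearMap.range f) := by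
    refine discreteTopology_of_isOpen_singleton_zero ?_
    have hF : {x : LinearMap.range f | ‖x‖ ≤ 1}.Finite := by
      refine ((hfin 1).image f.rangeRestrict).subset ?_
      rintro ⟨_, u, rfl⟩ hx
      exact ⟨u, hx, rfl⟩
    have e : ({0} : Set (LinearMap.range f)) = Metric.ball 0 1 ∩ ({x : LinearMap.range f | ‖x‖ ≤ 1} \ {0})ᶜ := by
      ext x
      simp only [Set.mem_singleton_iff, Set.mem_inter_iff, mem_ball_zero_iff, Set.mem_compl_iff, Set.mem_sdiff, Set.mem_ofPred_eq]
      constructor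
      · rintro rfl; simp
      · rintro ⟨h1, h2⟩
        by_contra h
        exact h2 ⟨h1.le, h⟩
    rw [e]
    exact Metric.isOpen_ball.inter (hF.sdiff.isClosed.isOpen_compl)
  haveI h1 : Module.Finite ℤ (LinearMap.range f) := inferInstance
  haveI h2 : Module.Finite ℤ (LinearMap.ker f) := by
    haveI : Finite (LinearMap.ker f) := by
      refine ((hfin 0).subset ?_).to_subtype
      intro u hu
      have : f u = 0 := hu
      simp [this]
    infer_instance
  have : Module.Finite ℤ (Additive Rˣ) := by
    haveI : Module.Finite ℤ (Additive Rˣ ⧸ LinearMap.ker f) :=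
      Module.Finite.equiv f.quotKerEquivRange.symm
    exact Module.Finite.of_submodule_quotient (LinearMap.ker f)
  exact Module.Finite.iff_addGroup_fg.1 this

lemma fin_quot {A : Type*} [AddCommGroup A] [AddGroup.FG A] (m : ℕ) (hm : m ≠ 0) :
    Finite (A ⧸ (nsmulAddMonoidHom (α := A) m).range) := by
  refine AddCommGroup.finite_of_fg_isAddTorsion _ ?_
  intro q
  obtain ⟨a, rfl⟩ := QuotientAddGroup.mk_surjective q
  rw [isOfFinAddOrder_iff_nsmul_eq_zero]
  refine ⟨m, Nat.pos_of_ne_zero hm, ?_⟩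
  rw [← QuotientAddGroup.mk_nsmul, QuotientAddGroup.eq_zero_iff]
  exact ⟨a, rfl⟩

include hs in
lemma sel_step3 (v : HeightOneSpectrum R) (m : ℕ) (hm : m ≠ 0) :
    (powMonoidHom m : Lˣ →* Lˣ).range.relIndex (UU R L) ≠ 0 := by
  classical
  haveI := units_fg s hs v
  haveI := fin_quot (A := Additive Rˣ) m hm
  have inj : Function.Injective (Units.map (algebraMap R L : R →* L)) :=
    Units.map_injective (IsFractionRing.injective R L)
  refine relIndex_of_map (T := Additive Rˣ ⧸ (nsmulAddMonoidHom (α := Additive Rˣ) m).range) _ _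
    (fun x => QuotientAddGroup.mk (Additive.ofMul (Function.invFun (Units.map (algebraMap R L : R →* L)) x))) ?_
  rintro _ ⟨x, rfl⟩ _ ⟨y, rfl⟩ hxy
  simp only [Function.leftInverse_invFun inj _] at hxy
  obtain ⟨z, hz⟩ := QuotientAddGroup.eq.1 hxy.symm
  refine ⟨Units.map (algebraMap R L : R →* L) z.toMul, ?_⟩
  rw [powMonoidHom_apply, ← map_pow, ← map_div]
  congr 1
  have : z.toMul ^ m = y⁻¹ * x := hz
  rw [this, div_eq_inv_mul]

include hs in
theorem selmer [Finite (ClassGroup R)] (v : HeightOneSpectrum R)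
    (S : Set (HeightOneSpectrum R)) (hS : S.Finite) (m : ℕ) (hm : m ≠ 0) :
    ∃ (n : ℕ) (f : Lˣ → Fin n), ∀ x ∈ Sel R L S m, ∀ y ∈ Sel R L S m, f x = f y →
      ∃ z, x = y * z ^ m := by
  have h3 := sel_step3 s hs v m hm
  have h3' : (powMonoidHom m : Lˣ →* Lˣ).range.relIndex (UU R L ⊔ (powMonoidHom m : Lˣ →* Lˣ).range) ≠ 0 := by
    rwa [sup_comm, Subgroup.relIndex_sup_left]
  have := Subgroup.relIndex_ne_zero_trans h3' (Subgroup.relIndex_ne_zero_trans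
    (sel_step2 (R := R) (L := L) m hm) (sel_step1 S hS m hm))
  obtain ⟨n, f, hf⟩ := map_of_relIndex _ _ this
  refine ⟨n, f, fun x hx y hy h => ?_⟩
  obtain ⟨z, hz⟩ := hf x hx y hy h
  refine ⟨z, ?_⟩
  have : z ^ m = x / y := hz
  rw [this]; simp

end units

end ded
end WMW

set_option linter.unusedSectionVars false
set_option linter.style.haveILetI false
namespace WMW
open Polynomial IsDedekindDomain
section inst
variable (Fq : Type*) [Field Fq] [Finite Fq]

instance hfq_poly : Ring.HasFiniteQuotients Fq[X] where
  finiteQuotient {I} hI := by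
    obtain ⟨f, rfl⟩ : ∃ f, I = Ideal.span {f} := ⟨_, (Ideal.span_singleton_generator I).symm⟩
    have hf : f ≠ 0 := by rintro rfl; simp at hI
    have : Module.Finite Fq (Fq[X] ⧸ Ideal.span {f}) :=
      PowerBasis.finite <| AdjoinRoot.powerBasis hf
    exact Module.finite_of_finite Fq

open Classical in
noncomputable def vinf : AbsoluteValue (RatFunc Fq) ℝ where
  toFun x := if x = 0 then 0 else (Nat.card Fq : ℝ) ^ x.intDegree
  map_mul' x y := by
    have : (Nat.card Fq : ℝ) ≠ 0 := by exact_mod_cast Nat.card_pos.ne'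
    by_cases hx : x = 0 <;> by_cases hy : y = 0 <;>
      simp [hx, hy, RatFunc.intDegree_mul, zpow_add₀ this]
  nonneg' x := by split_ifs <;> positivity
  eq_zero' x := by
    split_ifs with h
    · simp [h]
    · simp only [h, iff_false]; exact zpow_ne_zero _ (by exact_mod_cast Nat.card_pos.ne')
  add_le' x y := by
    have h1 : (1 : ℝ) ≤ Nat.card Fq := by exact_mod_cast Finite.one_lt_card.le
    by_cases hx : x = 0
    · simp [hx]
    by_cases hy : y = 0
    · simp [hy]
    by_cases hxy : x + y = 0
    · simp only [hxy, if_true]; split_ifs; positivity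
    simp only [hx, hy, hxy, if_false]
    have := RatFunc.intDegree_add_le hy hxy
    rcases le_max_iff.1 this with h | h
    · exact (zpow_le_zpow_right₀ h1 h).trans (le_add_of_nonneg_right (by positivity))
    · exact (zpow_le_zpow_right₀ h1 h).trans (le_add_of_nonneg_left (by positivity))

lemma vinf_def {x : RatFunc Fq} (hx : x ≠ 0) : vinf Fq x = (Nat.card Fq : ℝ) ^ x.intDegree := by
  simp [vinf, hx]

lemma vinf_na : IsNonarchimedean (vinf Fq) := by
  intro x y
  have h1 : (1 : ℝ) ≤ Nat.card Fq := by exact_mod_cast Finite.one_lt_card.le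
  by_cases hx : x = 0
  · simp [hx]
  by_cases hy : y = 0
  · simp [hy]
  by_cases hxy : x + y = 0
  · simp [hxy]
  rw [vinf_def _ hx, vinf_def _ hy, vinf_def _ hxy]
  have := RatFunc.intDegree_add_le hy hxy
  rcases le_max_iff.1 this with h | h
  · exact (zpow_le_zpow_right₀ h1 h).trans (le_max_left _ _)
  · exact (zpow_le_zpow_right₀ h1 h).trans (le_max_right _ _)

lemma vinf_nt : (vinf Fq).IsNontrivial := by
  refine ⟨RatFunc.X, RatFunc.X_ne_zero, ?_⟩
  rw [vinf_def _ RatFunc.X_ne_zero]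
  have : 1 < Nat.card Fq := Finite.one_lt_card
  simp
  omega

variable (L : Type*) [Field L] [Algebra Fq[X] L] [Algebra (RatFunc Fq) L]
  [IsScalarTower Fq[X] (RatFunc Fq) L] [FunctionField Fq L] [Algebra.IsSeparable (RatFunc Fq) L]

open FunctionField
instance faith_roi : FaithfulSMul Fq[X] (ringOfIntegers Fq L) :=
  (faithfulSMul_iff_algebraMap_injective _ _).2 (ringOfIntegers.algebraMap_injective Fq L)

instance hfq_roi : Ring.HasFiniteQuotients (ringOfIntegers Fq L) :=
  have : Module.Finite Fq[X] (ringOfIntegers Fq L) := inferInstance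
  have : Module.IsTorsionFree Fq[X] (ringOfIntegers Fq L) := inferInstance
  Ring.HasFiniteQuotients.of_module_finite Fq[X] _

instance inf_roi : Infinite (ringOfIntegers Fq L) :=
  Infinite.of_injective _ (ringOfIntegers.algebraMap_injective Fq L)

lemma exists_s : ∃ s : Multiset (AbsoluteValue L ℝ), ∀ r : ringOfIntegers Fq L, r ≠ 0 →
    (s.map (· (algebraMap (ringOfIntegers Fq L) L r))).prod =
      cq (ringOfIntegers Fq L) (Ideal.span {r}) := by
  obtain ⟨s, hs⟩ := exists_ext_abs (L := L) (vinf Fq) (vinf_na Fq) (vinf_nt Fq)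
  refine ⟨s, fun r hr => ?_⟩
  rw [hs]
  have : Module.Finite Fq[X] (ringOfIntegers Fq L) := inferInstance
  have : Module.IsTorsionFree Fq[X] (ringOfIntegers Fq L) := inferInstance
  have : Module.Free Fq[X] (ringOfIntegers Fq L) := inferInstance
  letI : Algebra Fq (ringOfIntegers Fq L) :=
    ((algebraMap Fq[X] (ringOfIntegers Fq L)).comp Polynomial.C).toAlgebra
  haveI : IsScalarTower Fq Fq[X] (ringOfIntegers Fq L) := IsScalarTower.of_algebraMap_eq' rfl
  have h1 : Algebra.norm (RatFunc Fq) (algebraMap (ringOfIntegers Fq L) L r) =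
      algebraMap Fq[X] (RatFunc Fq) (Algebra.norm Fq[X] r) := by
    rw [← Algebra.intNorm_eq_norm Fq[X], Algebra.algebraMap_intNorm (K := RatFunc Fq) (L := L)]
  have hn : Algebra.norm Fq[X] r ≠ 0 := Algebra.norm_ne_zero_iff.2 hr
  rw [h1, vinf_def _ (by simpa using hn), RatFunc.intDegree_polynomial,
    ← finrank_quotient_span_eq_natDegree_norm (Module.Free.chooseBasis Fq[X] _) hr]
  have hfin : Finite (ringOfIntegers Fq L ⧸ Ideal.span {r}) :=
    Ring.HasFiniteQuotients.finiteQuotient (by simpa using hr)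
  have : Module.Finite Fq (ringOfIntegers Fq L ⧸ Ideal.span {r}) := Module.Finite.of_finite
  have h2 : cq (ringOfIntegers Fq L) (Ideal.span {r}) =
    Nat.card (ringOfIntegers Fq L ⧸ Ideal.span {r}) := rfl
  rw [h2, Module.natCard_eq_pow_finrank (K := Fq) (V := ringOfIntegers Fq L ⧸ Ideal.span {r})]
  push_cast
  rw [zpow_natCast]

lemma exists_hos : Nonempty (HeightOneSpectrum (ringOfIntegers Fq L)) := by
  obtain ⟨M, hM, hM'⟩ := Ring.not_isField_iff_exists_prime.1 (ringOfIntegers.not_isField Fq L)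
  exact ⟨⟨M, hM', hM⟩⟩

lemma fin_cl : Finite (ClassGroup (ringOfIntegers Fq L)) := by
  have := Fintype.ofFinite Fq
  exact inferInstance
end inst
end WMW

set_option linter.unusedSectionVars false
set_option linter.style.haveILetI false
namespace WMW
open IsDedekindDomain WithZero

/-- finite classification of elements whose valuations are m-th powers outside a finite set -/
def HasSel {I L : Type*} [Field L] (v : I → Valuation L (WithZero (Multiplicative ℤ))) (m : ℕ) : Prop :=
  ∀ t : Finset L, ∃ (n : ℕ) (f : L → Option (Fin n)), ∀ x y : L, x ≠ 0 → y ≠ 0 →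
    (∀ i, (∀ a ∈ t, a ≠ 0 → v i a = 1) → ∃ w, v i x = w ^ m) →
    (∀ i, (∀ a ∈ t, a ≠ 0 → v i a = 1) → ∃ w, v i y = w ^ m) →
    f x = f y → ∃ z, x = y * z ^ m

lemma hasSel {R L : Type*} [CommRing R] [IsDedekindDomain R] [Infinite R] [Ring.HasFiniteQuotients R]
    [Field L] [Algebra R L] [IsFractionRing R L] (s : Multiset (AbsoluteValue L ℝ))
    (hs : ∀ r : R, r ≠ 0 → (s.map (· (algebraMap R L r))).prod = cq R (Ideal.span {r}))
    [Finite (ClassGroup R)] (v : HeightOneSpectrum R) (m : ℕ) (hm : m ≠ 0) :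
    HasSel (fun v : HeightOneSpectrum R => v.valuation L) m := by
  classical
  intro t
  let S : Set (HeightOneSpectrum R) := {v | ¬ ∀ a ∈ t, a ≠ 0 → v.valuation L a = 1}
  have hS : S.Finite := by
    have : S ⊆ ⋃ a ∈ t.subtype (· ≠ 0), {v | v.valuationOfNeZero (K := L) (Units.mk0 _ a.2) ≠ 1} := by
      intro v hv
      simp only [S, Set.mem_setOf_eq, not_forall] at hv
      obtain ⟨a, ha, h0, h⟩ := hv
      simp only [Set.mem_iUnion]
      refine ⟨⟨a, h0⟩, by simpa using ha, fun h' => h ?_⟩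
      have := v.valuationOfNeZero_eq (Units.mk0 a h0)
      rw [h'] at this
      simpa using this.symm
    exact (Set.Finite.biUnion (Finset.finite_toSet _) fun a _ => val_fin _).subset this
  obtain ⟨n, f, hf⟩ := selmer s hs v S hS m hm
  refine ⟨n, fun x => if h : x = 0 then none else some (f (Units.mk0 x h)), ?_⟩
  have key : ∀ x (hx : x ≠ 0), (∀ v : HeightOneSpectrum R, (∀ a ∈ t, a ≠ 0 → v.valuation L a = 1) →
      ∃ w, v.valuation L x = w ^ m) → Units.mk0 x hx ∈ Sel R L S m := by
    intro x hx h v hv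
    have hv' : ∀ a ∈ t, a ≠ 0 → v.valuation L a = 1 := by
      by_contra h; exact hv h
    obtain ⟨w, hw⟩ := h v hv'
    have h1 := v.valuationOfNeZero_eq (Units.mk0 x hx)
    rw [Units.val_mk0, hw] at h1
    have hw0 : w ≠ 0 := by
      rintro rfl
      rw [zero_pow hm] at h1
      exact WithZero.coe_ne_zero h1
    obtain ⟨w', rfl⟩ := WithZero.ne_zero_iff_exists.1 hw0
    rw [← WithZero.coe_pow, WithZero.coe_inj] at h1
    rw [h1]
    exact ⟨w'.toAdd, by simp⟩
  intro x y hx hy h1 h2 h3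
  simp only [hx, hy, dif_neg, not_false_eq_true, Option.some.injEq] at h3
  obtain ⟨z, hz⟩ := hf _ (key x hx h1) _ (key y hy h2) h3
  exact ⟨z, by simpa using congrArg Units.val hz⟩

lemma coset_fin {A T : Type*} [AddCommGroup A] [Finite T] (m : ℕ) (Z : Set A) (hZ : Z.Finite)
    (c : A → T) (H : ∀ P Q, P ∉ Z → Q ∉ Z → c P = c Q → P - Q ∉ Z → ∃ Q', P - Q = m • Q') :
    (nsmulAddMonoidHom (α := A) m).range.FiniteIndex := by
  classical
  set B := (nsmulAddMonoidHom (α := A) m).range with hB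
  suffices Finite (A ⧸ B) from AddSubgroup.finiteIndex_of_finite_quotient
  let π := QuotientAddGroup.mk' B
  let rep : T → A := fun t => if h : ∃ P, P ∉ Z ∧ c P = t then h.choose else 0
  have hrep : ∀ P, P ∉ Z → rep (c P) ∉ Z ∧ c (rep (c P)) = c P := by
    intro P hP
    have h : ∃ P', P' ∉ Z ∧ c P' = c P := ⟨P, hP, rfl⟩
    simp only [rep, dif_pos h]
    exact h.choose_spec
  have hfin : (π '' Z ∪ ⋃ t, ((fun z => π (rep t) + z) '' ({0} ∪ π '' Z))).Finite :=
    (hZ.image _).union (Set.finite_iUnion fun t => ((Set.finite_singleton _).union (hZ.image _)).image _)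
  refine Set.finite_univ_iff.1 (hfin.subset ?_)
  intro q _
  obtain ⟨P, rfl⟩ := QuotientAddGroup.mk'_surjective B q
  by_cases hP : P ∈ Z
  · exact Or.inl ⟨P, hP, rfl⟩
  refine Or.inr (Set.mem_iUnion.2 ⟨c P, ?_⟩)
  obtain ⟨h1, h2⟩ := hrep P hP
  have e : π P = π (rep (c P)) + π (P - rep (c P)) := by rw [← map_add]; congr 1; abel
  by_cases h3 : P - rep (c P) ∈ Z
  · exact ⟨_, Or.inr ⟨_, h3, rfl⟩, e.symm⟩
  · refine ⟨_, Or.inl rfl, ?_⟩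
    obtain ⟨Q', hQ'⟩ := H P _ hP h1 h2.symm h3
    have : π (P - rep (c P)) = 0 := (QuotientAddGroup.eq_zero_iff _).2 ⟨Q', hQ'.symm⟩
    rw [this] at e
    exact e.symm
end WMW

set_option linter.unusedSectionVars false
set_option linter.style.haveILetI false
namespace WMW
open WeierstrassCurve WithZero

lemma val_two {L : Type*} [Field L] (v : Valuation L (WithZero (Multiplicative ℤ)))
    {a b c y : L} (ha : a ≠ 0) (h : y ^ 2 = a * b * c) (hb : v (a - b) = 1) (hc : v (a - c) = 1) :
    ∃ w, v a = w ^ 2 := by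
  have h0 : v a ≠ 0 := (v.ne_zero_iff).2 ha
  have hv : v y ^ 2 = v a * v b * v c := by rw [← map_pow, h, map_mul, map_mul]
  rcases lt_trichotomy (v a) 1 with h1 | h1 | h1
  · have e : ∀ b, v (a - b) = 1 → v b = 1 := by
      intro b hb
      have := v.map_sub_eq_of_lt_left (x := a - b) (y := a) (by rw [hb]; exact h1)
      rw [hb] at this
      rw [← this, ← v.map_neg]; congr 1; ring
    rw [e b hb, e c hc] at hv
    exact ⟨v y, by rw [hv]; simp⟩
  · exact ⟨1, by simpa using h1⟩
  · have e : ∀ b, v (a - b) = 1 → v b = v a := by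
      intro b hb
      have := v.map_sub_eq_of_lt_right (x := a - b) (y := a) (by rw [hb]; exact h1)
      rw [← this, ← v.map_neg]; congr 1; ring
    rw [e b hb, e c hc] at hv
    refine ⟨v y / v a, ?_⟩
    rw [div_pow, hv]
    field_simp

section leg
variable {L : Type*} [Field L] [DecidableEq L]

/-- y² = (x-e₁)(x-e₂)(x-e₃) -/
def leg (e₁ e₂ e₃ : L) : WeierstrassCurve L :=
  ⟨0, -(e₁ + e₂ + e₃), 0, e₁ * e₂ + e₁ * e₃ + e₂ * e₃, -(e₁ * e₂ * e₃)⟩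

lemma leg_eq (e₁ e₂ e₃ x y : L) : (leg e₁ e₂ e₃).toAffine.Equation x y ↔
    y ^ 2 = (x - e₁) * (x - e₂) * (x - e₃) := by
  rw [Affine.equation_iff]
  simp only [leg]
  constructor <;> intro h <;> linear_combination h

lemma leg_halve (h2 : (2 : L) ≠ 0) {e₁ e₂ e₃ x y r₁ r₂ r₃ : L} [(leg e₁ e₂ e₃).IsElliptic]
    (h12 : e₁ ≠ e₂) (h13 : e₁ ≠ e₃) (h23 : e₂ ≠ e₃)
    (h : (leg e₁ e₂ e₃).toAffine.Nonsingular x y)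
    (h₁ : x - e₁ = r₁ ^ 2) (h₂ : x - e₂ = r₂ ^ 2) (h₃ : x - e₃ = r₃ ^ 2) (hy : y = r₁ * r₂ * r₃) :
    ∃ Q : (leg e₁ e₂ e₃).toAffine.Point, Affine.Point.some x y h = 2 • Q := by
  have A : r₁ + r₂ ≠ 0 := fun h => h12 (by linear_combination h₂ - h₁ - (r₁ - r₂) * h)
  have B : r₁ + r₃ ≠ 0 := fun h => h13 (by linear_combination h₃ - h₁ - (r₁ - r₃) * h)
  have C : r₂ + r₃ ≠ 0 := fun h => h23 (by linear_combination h₃ - h₂ - (r₂ - r₃) * h)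
  obtain rfl : e₁ = x - r₁ ^ 2 := by linear_combination -h₁
  obtain rfl : e₂ = x - r₂ ^ 2 := by linear_combination -h₂
  obtain rfl : e₃ = x - r₃ ^ 2 := by linear_combination -h₃
  have hQ : (leg (x - r₁ ^ 2) (x - r₂ ^ 2) (x - r₃ ^ 2)).toAffine.Nonsingular
      (x + r₁ * r₂ + r₁ * r₃ + r₂ * r₃) ((r₁ + r₂) * (r₁ + r₃) * (r₂ + r₃)) := by
    rw [← Affine.equation_iff_nonsingular, leg_eq]; ring
  refine ⟨.some _ _ hQ, ?_⟩
  rw [two_nsmul]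
  have hne : (r₁ + r₂) * (r₁ + r₃) * (r₂ + r₃) ≠ 0 := by positivity
  have hy' : (r₁ + r₂) * (r₁ + r₃) * (r₂ + r₃) ≠
      (leg (x - r₁ ^ 2) (x - r₂ ^ 2) (x - r₃ ^ 2)).toAffine.negY
      (x + r₁ * r₂ + r₁ * r₃ + r₂ * r₃) ((r₁ + r₂) * (r₁ + r₃) * (r₂ + r₃)) := by
    simp only [Affine.negY, leg]
    intro h
    apply mul_ne_zero h2 hne
    linear_combination h
  have hs : (leg (x - r₁ ^ 2) (x - r₂ ^ 2) (x - r₃ ^ 2)).toAffine.slope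
      (x + r₁ * r₂ + r₁ * r₃ + r₂ * r₃) (x + r₁ * r₂ + r₁ * r₃ + r₂ * r₃)
      ((r₁ + r₂) * (r₁ + r₃) * (r₂ + r₃)) ((r₁ + r₂) * (r₁ + r₃) * (r₂ + r₃)) = r₁ + r₂ + r₃ := by
    rw [Affine.slope_of_Y_ne rfl hy', div_eq_iff (sub_ne_zero.2 hy')]
    simp only [Affine.negY, leg]
    ring
  rw [Affine.Point.add_self_of_Y_ne hy', Affine.Point.some.injEq, hs]
  subst hy
  constructor
  · simp only [Affine.addX, leg]; ring
  · simp only [Affine.addY, Affine.negAddY, Affine.negY, Affine.addX, leg]; ring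

/-- value at `e` of the cubic cut out by a line -/
lemma line_eval (W : WeierstrassCurve L) {x₁ y₁ x₂ y₂ : L} (h₁ : W.toAffine.Equation x₁ y₁)
    (h₂ : W.toAffine.Equation x₂ y₂) (hxy : ¬(x₁ = x₂ ∧ y₁ = W.toAffine.negY x₂ y₂)) (e : L) :
    ∃ k, (e - x₁) * (e - x₂) * (e - W.toAffine.addX x₁ x₂ (W.toAffine.slope x₁ x₂ y₁ y₂)) =
      e ^ 3 + W.a₂ * e ^ 2 + W.a₄ * e + W.a₆ - (k ^ 2 + W.a₁ * e * k + W.a₃ * k) := by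
  have := congrArg (Polynomial.eval e) (Affine.addPolynomial_slope h₁ h₂ hxy)
  rw [Affine.addPolynomial_eq] at this
  simp [Cubic.toPoly] at this
  refine ⟨W.toAffine.slope x₁ x₂ y₁ y₂ * (e - x₁) + y₁, ?_⟩
  rw [Affine.addX]
  linear_combination this

lemma leg_line {e₁ e₂ e₃ x₁ y₁ x₂ y₂ : L} (h₁ : (leg e₁ e₂ e₃).toAffine.Equation x₁ y₁)
    (h₂ : (leg e₁ e₂ e₃).toAffine.Equation x₂ y₂)
    (hxy : ¬(x₁ = x₂ ∧ y₁ = (leg e₁ e₂ e₃).toAffine.negY x₂ y₂)) {e : L}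
    (he : e = e₁ ∨ e = e₂ ∨ e = e₃) :
    ∃ k, (x₁ - e) * (x₂ - e) * ((leg e₁ e₂ e₃).toAffine.addX x₁ x₂
      ((leg e₁ e₂ e₃).toAffine.slope x₁ x₂ y₁ y₂) - e) = k ^ 2 := by
  obtain ⟨k, hk⟩ := line_eval _ h₁ h₂ hxy e
  have : e ^ 3 + (leg e₁ e₂ e₃).a₂ * e ^ 2 + (leg e₁ e₂ e₃).a₄ * e + (leg e₁ e₂ e₃).a₆ = 0 := by
    simp only [leg]; rcases he with rfl | rfl | rfl <;> ring
  refine ⟨k, ?_⟩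
  rw [this] at hk
  have h1 : (leg e₁ e₂ e₃).a₁ = 0 := rfl
  have h3 : (leg e₁ e₂ e₃).a₃ = 0 := rfl
  rw [h1, h3] at hk
  linear_combination -hk

theorem leg_fin {I : Type*} (v : I → Valuation L (WithZero (Multiplicative ℤ))) (hv : HasSel v 2)
    (h2 : (2 : L) ≠ 0) {e₁ e₂ e₃ : L} [(leg e₁ e₂ e₃).IsElliptic]
    (h12 : e₁ ≠ e₂) (h13 : e₁ ≠ e₃) (h23 : e₂ ≠ e₃) :
    (nsmulAddMonoidHom (α := (leg e₁ e₂ e₃).toAffine.Point) 2).range.FiniteIndex := by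
  obtain ⟨n, f, hf⟩ := hv {e₁ - e₂, e₁ - e₃, e₂ - e₃}
  set W := leg e₁ e₂ e₃ with hW
  have eqn : ∀ x y, W.toAffine.Equation x y ↔ y ^ 2 = (x - e₁) * (x - e₂) * (x - e₃) := leg_eq _ _ _
  let c : W.toAffine.Point → Option (Fin n) × Option (Fin n) × Option (Fin n) := fun P =>
    match P with
    | 0 => (none, none, none)
    | .some x y h => (f (x - e₁), f (x - e₂), f (x - e₃))
  have hn : ∀ e, e = e₁ ∨ e = e₂ ∨ e = e₃ → W.toAffine.Nonsingular e 0 := by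
    intro e he
    rw [← Affine.equation_iff_nonsingular, eqn]
    rcases he with rfl | rfl | rfl <;> ring
  let Z : Set W.toAffine.Point := {0, .some e₁ 0 (hn _ (.inl rfl)), .some e₂ 0 (hn _ (.inr (.inl rfl))),
    .some e₃ 0 (hn _ (.inr (.inr rfl)))}
  have hZ : Z.Finite := by simp [Z]
  have good : ∀ x y h, Affine.Point.some x y h ∉ Z → y ≠ 0 ∧ x - e₁ ≠ 0 ∧ x - e₂ ≠ 0 ∧ x - e₃ ≠ 0 := by
    intro x y h hz
    have e := (eqn _ _).1 h.1
    have : y ≠ 0 := by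
      rintro rfl
      apply hz
      simp only [Z, Set.mem_insert_iff, Set.mem_singleton_iff, Affine.Point.some.injEq, and_true]
      right
      have e : (x - e₁) * (x - e₂) * (x - e₃) = 0 := by rw [← e]; ring
      simpa [sub_eq_zero, or_assoc] using e
    refine ⟨this, ?_⟩
    have : (x - e₁) * (x - e₂) * (x - e₃) ≠ 0 := by rw [← e]; positivity
    simpa [and_assoc] using this
  have vals : ∀ x y h, Affine.Point.some x y h ∉ Z → ∀ e, e = e₁ ∨ e = e₂ ∨ e = e₃ →
      ∀ i, (∀ a ∈ ({e₁ - e₂, e₁ - e₃, e₂ - e₃} : Finset L), a ≠ 0 → v i a = 1) →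
      ∃ w, v i (x - e) = w ^ 2 := by
    intro x y h hz e he i hi
    have E := (eqn _ _).1 h.1
    obtain ⟨-, g1, g2, g3⟩ := good x y h hz
    have i1 := hi (e₁ - e₂) (by simp) (sub_ne_zero.2 h12)
    have i2 := hi (e₁ - e₃) (by simp) (sub_ne_zero.2 h13)
    have i3 := hi (e₂ - e₃) (by simp) (sub_ne_zero.2 h23)
    have i1' : v i (e₂ - e₁) = 1 := by rw [← i1, (v i).map_sub_swap]
    have i2' : v i (e₃ - e₁) = 1 := by rw [← i2, (v i).map_sub_swap]
    have i3' : v i (e₃ - e₂) = 1 := by rw [← i3, (v i).map_sub_swap]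
    rcases he with rfl | rfl | rfl
    · exact val_two (v i) g1 E (by rw [← i1']; congr 1; ring) (by rw [← i2']; congr 1; ring)
    · exact val_two (v i) g2 (E.trans (by ring : _ = (x - e) * (x - e₁) * (x - e₃)))
        (by rw [← i1]; congr 1; ring) (by rw [← i3']; congr 1; ring)
    · exact val_two (v i) g3 (E.trans (by ring : _ = (x - e) * (x - e₁) * (x - e₂)))
        (by rw [← i2]; congr 1; ring) (by rw [← i3]; congr 1; ring)
  refine coset_fin 2 Z hZ c ?_
  intro P Q hP hQ hc hPQ
  cases P with
  | zero => exact absurd (by simp [Z, Affine.Point.zero_def]) hP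
  | some x₁ y₁ k₁ =>
  cases Q with
  | zero => exact absurd (by simp [Z, Affine.Point.zero_def]) hQ
  | some x₂ y₂ k₂ =>
  rw [sub_eq_add_neg, Affine.Point.neg_some] at hPQ ⊢
  have k₂' := (Affine.nonsingular_neg x₂ y₂).2 k₂
  by_cases hxy : x₁ = x₂ ∧ y₁ = W.toAffine.negY x₂ (W.toAffine.negY x₂ y₂)
  · rw [Affine.Point.add_of_Y_eq hxy.1 hxy.2]
    exact ⟨0, by simp⟩
  rw [Affine.Point.add_some hxy] at hPQ ⊢
  obtain ⟨g0, g1, g2, g3⟩ := good _ _ _ hPQ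
  obtain ⟨p0, p1, p2, p3⟩ := good _ _ _ hP
  obtain ⟨q0, q1, q2, q3⟩ := good _ _ _ hQ
  have key : ∀ e, e = e₁ ∨ e = e₂ ∨ e = e₃ → x₁ - e ≠ 0 → x₂ - e ≠ 0 → f (x₁ - e) = f (x₂ - e) →
      ∃ r, W.toAffine.addX x₁ x₂ (W.toAffine.slope x₁ x₂ y₁ (W.toAffine.negY x₂ y₂)) - e = r ^ 2 := by
    intro e he n1 n2 hfe
    obtain ⟨k, hk⟩ := leg_line k₁.1 k₂'.1 hxy he
    obtain ⟨z, hz⟩ := hf _ _ n1 n2 (vals _ _ _ hP e he) (vals _ _ _ hQ e he) hfe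
    have hz0 : z ≠ 0 := by rintro rfl; apply n1; rw [hz]; ring
    rw [hz] at hk
    refine ⟨k / ((x₂ - e) * z), ?_⟩
    rw [div_pow, eq_div_iff (by positivity), ← hk]
    ring
  simp only [c, Prod.mk.injEq] at hc
  obtain ⟨r₁, hr₁⟩ := key e₁ (.inl rfl) p1 q1 hc.1
  obtain ⟨r₂, hr₂⟩ := key e₂ (.inr (.inl rfl)) p2 q2 hc.2.1
  obtain ⟨r₃, hr₃⟩ := key e₃ (.inr (.inr rfl)) p3 q3 hc.2.2
  have hns := Affine.nonsingular_add k₁ k₂' hxy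
  have E := (eqn _ _).1 hns.1
  rw [hr₁, hr₂, hr₃] at E
  have E' : W.toAffine.addY x₁ x₂ y₁ (W.toAffine.slope x₁ x₂ y₁ (W.toAffine.negY x₂ y₂)) ^ 2 =
    (r₁ * r₂ * r₃) ^ 2 := by rw [E]; ring
  rcases sq_eq_sq_iff_eq_or_eq_neg.1 E' with h | h
  · exact leg_halve h2 h12 h13 h23 hns hr₁ hr₂ hr₃ h
  · exact leg_halve h2 h12 h13 h23 hns (r₁ := -r₁) (by rw [hr₁]; ring) hr₂ hr₃ (by rw [h]; ring)
end leg
end WMW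

set_option linter.unusedSectionVars false
set_option linter.style.haveILetI false
set_option linter.unusedVariables false
namespace WMW
open WeierstrassCurve

/-- y² + dxy + y = x³ -/
def ed {L : Type*} [Field L] (d : L) : WeierstrassCurve L := ⟨d, 0, 1, 0, 0⟩

lemma ed_eq {L : Type*} [Field L] (d x y : L) : (ed d).toAffine.Equation x y ↔
    y ^ 2 + d * x * y + y = x ^ 3 := by
  rw [Affine.equation_iff]
  simp only [ed]
  constructor <;> intro h <;> linear_combination h

section ch2
variable {L : Type*} [Field L] [DecidableEq L]
lemma ids (h2 : (2 : L) = 0) {ω : L} (hω : ω ^ 2 + ω + 1 = 0) {d δ b c k i s₀ s₁ s₂ σ₀ σ₁ σ₂ m x y : L}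
    (hδ : δ ^ 3 = d ^ 3 + 1) (hd : d = δ * (1 + b ^ 3 + c ^ 3) * k) (hk : b * c * k = 1)
    (h0 : s₀ = d + δ * σ₀) (h1 : s₁ = d + δ * σ₁)
    (h2 : s₂ = d + δ * σ₂) (e0 : σ₀ = b + c) (e1 : σ₁ = ω * b + ω ^ 2 * c)
    (e2 : σ₂ = ω ^ 2 * b + ω * c) (hi : σ₀ * i = 1) (hm : m = s₂ * σ₁ * i)
    (hx : x = s₁ * s₂) (hy : y = s₁ * s₂ ^ 2) :
    s₀ * s₁ * s₂ = 1 ∧ y ^ 2 + d * x * y + y = x ^ 3 ∧ d * x + 1 = δ * σ₀ * x ∧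
    m * (d * x + 1) = x ^ 2 + d * y ∧
    m ^ 2 + d * m + x = b * c * x * i ^ 2 := by
  have hs : s₀ * s₁ * s₂ = 1 := by subst h0 h1 h2 e0 e1 e2; grind
  have hss : s₀ + s₁ + s₂ = d := by subst h0 h1 h2 e0 e1 e2; grind
  have A : d * x + 1 = δ * σ₀ * x := by grind
  refine ⟨hs, by grind, A, by grind, ?_⟩
  have e : s₂ * σ₁ ^ 2 + d * σ₀ * σ₁ + s₁ * σ₀ ^ 2 = b * c * s₁ := by
    clear hs hss A hm hx hy hi hd hk hδ; subst h0 h1 h2 e0 e1 e2; grind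
  subst hm hx
  linear_combination (s₂ * i ^ 2) * e - (d * s₂ * σ₁ * i + s₁ * s₂ * (1 + σ₀ * i)) * hi

lemma ids2 (h2 : (2 : L) = 0) {ω : L} (hω : ω ^ 2 + ω + 1 = 0) {d δ b c k s₁ s₂ σ₀ σ₁ σ₂ D x y : L}
    (hd : d = δ * (1 + b ^ 3 + c ^ 3) * k) (hk : b * c * k = 1)
    (h1 : s₁ = d + δ * σ₁)
    (h2 : s₂ = d + δ * σ₂) (e0 : σ₀ = b + c) (e1 : σ₁ = ω * b + ω ^ 2 * c)
    (e2 : σ₂ = ω ^ 2 * b + ω * c) (hD : D = δ * σ₀ ^ 3 * k) (hx : x = s₁ * s₂) :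
    x + D * (D + d) = δ ^ 2 * k ^ 2 * (1 + ω ^ 2 * b ^ 3 + ω * c ^ 3) * (1 + ω * b ^ 3 + ω ^ 2 * c ^ 3) := by
  have : s₁ * s₂ = δ ^ 2 * k ^ 2 * ((1 + b ^ 3 + c ^ 3 + b * c * σ₁) * (1 + b ^ 3 + c ^ 3 + b * c * σ₂)) := by
    clear hx hD
    subst h1 h2 hd
    linear_combination (-(δ ^ 2 * σ₁ * σ₂ * (1 + b * c * k)) -δ ^ 2 * (1 + b ^ 3 + c ^ 3) * k * (σ₁ + σ₂)) * hk
  rw [hx, this]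
  subst hD hd h1 h2 e0 e1 e2
  clear this hx
  have : (1 + b ^ 3 + c ^ 3 + b * c * (ω * b + ω ^ 2 * c)) * (1 + b ^ 3 + c ^ 3 + b * c * (ω ^ 2 * b + ω * c))
    + (b + c) ^ 3 * ((b + c) ^ 3 + 1 + b ^ 3 + c ^ 3) =
     (1 + ω ^ 2 * b ^ 3 + ω * c ^ 3) * (1 + ω * b ^ 3 + ω ^ 2 * c ^ 3) := by
    grind
  linear_combination δ ^ 2 * k ^ 2 * this

lemma ids3 (h2 : (2 : L) = 0) {ω : L} (hω : ω ^ 2 + ω + 1 = 0) {d δ b c k s₁ s₂ σ₀ σ₁ σ₂ D x y : L}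
    (hd : d = δ * (1 + b ^ 3 + c ^ 3) * k) (hk : b * c * k = 1)
    (h1 : s₁ = d + δ * σ₁)
    (h2 : s₂ = d + δ * σ₂) (e0 : σ₀ = b + c) (e1 : σ₁ = ω * b + ω ^ 2 * c)
    (e2 : σ₂ = ω ^ 2 * b + ω * c) (hD : D = δ * σ₀ ^ 3 * k) (hx : x = s₁ * s₂) (hy : y = s₁ * s₂ ^ 2) :
    y + δ * σ₀ * x + (D + d) * (δ * σ₀ ^ 2 * σ₁ * k * s₂ + D ^ 2) =
      δ ^ 3 * k ^ 3 * (1 + ω ^ 2 * b ^ 3 + ω * c ^ 3) ^ 3 := by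
  have E1 : s₁ = δ * k * (1 + b ^ 3 + c ^ 3 + b * c * σ₁) := by
    rw [h1, hd]; linear_combination (-(δ * σ₁)) * hk
  have E2 : s₂ = δ * k * (1 + b ^ 3 + c ^ 3 + b * c * σ₂) := by
    rw [h2, hd]; linear_combination (-(δ * σ₂)) * hk
  have E3 : σ₀ * x = k ^ 3 * δ ^ 2 * (b * c * σ₀ * (1 + b ^ 3 + c ^ 3 + b * c * σ₁) * (1 + b ^ 3 + c ^ 3 + b * c * σ₂)) := by
    rw [hx, E1, E2]; linear_combination (-(σ₀ * δ ^ 2 * k ^ 2 * (1 + b ^ 3 + c ^ 3 + b * c * σ₁) * (1 + b ^ 3 + c ^ 3 + b * c * σ₂))) * hk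
  have key : (1 + b ^ 3 + c ^ 3 + b * c * σ₁) * (1 + b ^ 3 + c ^ 3 + b * c * σ₂) ^ 2 +
      b * c * σ₀ * (1 + b ^ 3 + c ^ 3 + b * c * σ₁) * (1 + b ^ 3 + c ^ 3 + b * c * σ₂) +
      (σ₀ ^ 3 + (1 + b ^ 3 + c ^ 3)) * (σ₀ ^ 2 * σ₁ * (1 + b ^ 3 + c ^ 3 + b * c * σ₂) + σ₀ ^ 6) =
      (1 + ω ^ 2 * b ^ 3 + ω * c ^ 3) ^ 3 := by
    clear E1 E2 E3 hx hy hD hd h1 h2 hk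
    subst e0 e1 e2
    grind
  have E5 : (D + d) * (δ * σ₀ ^ 2 * σ₁ * k * s₂ + D ^ 2) = k ^ 3 * δ ^ 3 * ((σ₀ ^ 3 + (1 + b ^ 3 + c ^ 3)) * (σ₀ ^ 2 * σ₁ * (1 + b ^ 3 + c ^ 3 + b * c * σ₂) + σ₀ ^ 6)) := by
    rw [hD, hd, E2]; ring
  rw [E5, mul_assoc δ, E3, hy, E1, E2]
  linear_combination δ ^ 3 * k ^ 3 * key
end ch2
end WMW

set_option linter.unusedSectionVars false
set_option linter.style.haveILetI false
set_option linter.unusedVariables false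
namespace WMW
open WeierstrassCurve

section ch2
variable {L : Type*} [Field L] [DecidableEq L]

lemma trisect (h2 : (2 : L) = 0) {ω : L} (hω : ω ^ 2 + ω + 1 = 0) {d δ b c k xp yp : L}
    (hδ : δ ^ 3 = d ^ 3 + 1) (hδ0 : δ ≠ 0) (hd : d = δ * (1 + b ^ 3 + c ^ 3) * k) (hk : b * c * k = 1)
    (hσ : b + c ≠ 0) [(ed d).IsElliptic]
    (h : (ed d).toAffine.Nonsingular xp yp)
    (hx : xp = δ ^ 2 * k ^ 2 * (1 + ω ^ 2 * b ^ 3 + ω * c ^ 3) * (1 + ω * b ^ 3 + ω ^ 2 * c ^ 3))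
    (hy : yp = δ ^ 3 * k ^ 3 * (1 + ω ^ 2 * b ^ 3 + ω * c ^ 3) ^ 3) :
    ∃ Q : (ed d).toAffine.Point, Affine.Point.some xp yp h = 3 • Q := by
  obtain ⟨σ₀, e0⟩ : ∃ t, t = b + c := ⟨_, rfl⟩
  obtain ⟨σ₁, e1⟩ : ∃ t, t = ω * b + ω ^ 2 * c := ⟨_, rfl⟩
  obtain ⟨σ₂, e2⟩ : ∃ t, t = ω ^ 2 * b + ω * c := ⟨_, rfl⟩
  obtain ⟨s₀, h0⟩ : ∃ t, t = d + δ * σ₀ := ⟨_, rfl⟩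
  obtain ⟨s₁, h1⟩ : ∃ t, t = d + δ * σ₁ := ⟨_, rfl⟩
  obtain ⟨s₂, h2'⟩ : ∃ t, t = d + δ * σ₂ := ⟨_, rfl⟩
  obtain ⟨i, hi⟩ : ∃ i, σ₀ * i = 1 := ⟨_, mul_inv_cancel₀ (e0 ▸ hσ)⟩
  obtain ⟨m, hm⟩ : ∃ t, t = s₂ * σ₁ * i := ⟨_, rfl⟩
  obtain ⟨x, hxq⟩ : ∃ t, t = s₁ * s₂ := ⟨_, rfl⟩
  obtain ⟨y, hyq⟩ : ∃ t, t = s₁ * s₂ ^ 2 := ⟨_, rfl⟩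
  obtain ⟨D, hD⟩ : ∃ t, t = δ * σ₀ ^ 3 * k := ⟨_, rfl⟩
  obtain ⟨i1, i2, i3, i4, i5⟩ := ids h2 hω hδ hd hk h0 h1 h2' e0 e1 e2 hi hm hxq hyq
  have j1 := ids2 (y := y) h2 hω hd hk h1 h2' e0 e1 e2 hD hxq
  have j2 := ids3 h2 hω hd hk h1 h2' e0 e1 e2 hD hxq hyq
  rw [← hx] at j1
  rw [← hy] at j2
  have hx0 : x ≠ 0 := by
    rintro h; rw [mul_assoc, ← hxq, h] at i1; simp at i1
  have hσ0 : σ₀ ≠ 0 := e0 ▸ hσ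
  have hne : d * x + 1 ≠ 0 := by rw [i3]; positivity
  have hb : b * c ≠ 0 := left_ne_zero_of_mul (by rw [hk]; exact one_ne_zero)
  have hi0 : i ≠ 0 := right_ne_zero_of_mul (by rw [hi]; exact one_ne_zero)
  have hQ : (ed d).toAffine.Nonsingular x y := by
    rw [← Affine.equation_iff_nonsingular, ed_eq]; exact i2
  refine ⟨.some x y hQ, ?_⟩
  have hne' : y ≠ (ed d).toAffine.negY x y := by
    simp only [Affine.negY, ed]
    intro h; apply hne; linear_combination -y * h2 + h
  have hs : (ed d).toAffine.slope x x y y = m := by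
    rw [Affine.slope_of_Y_ne rfl hne', div_eq_iff (sub_ne_zero.2 hne')]
    simp only [Affine.negY, ed]
    linear_combination -i4 + (x ^ 2 - d * y - m * y) * h2
  rw [succ_nsmul, two_nsmul, Affine.Point.add_self_of_Y_ne hne']
  have exr : (ed d).toAffine.addX x x m = m ^ 2 + d * m - 2 * x := by
    simp only [Affine.addX, ed]; ring
  simp only [hs]
  set xr := (ed d).toAffine.addX x x m with hxr
  set yr := (ed d).toAffine.addY x x y m with hyr
  have eyr : yr = -(m * (xr - x) + y) - d * xr - 1 := by
    simp only [hyr, hxr, Affine.addY, Affine.negAddY, Affine.negY, ed]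
  have hX : xr + x = b * c * x * i ^ 2 := by rw [exr]; linear_combination i5 - x * h2
  have hrx : xr ≠ x := by
    intro h
    have : b * c * x * i ^ 2 ≠ 0 := by positivity
    apply this; rw [← hX, h]; linear_combination x * h2
  have hslope : (ed d).toAffine.slope xr x yr y = m + d + D := by
    rw [Affine.slope_of_X_ne hrx, div_eq_iff (sub_ne_zero.2 hrx), eyr]
    have : D * (xr + x) = d * x + 1 := by
      rw [hX, i3, hD]
      linear_combination (δ * σ₀ ^ 3 * i ^ 2 * x) * hk + (δ * σ₀ * x * (σ₀ * i + 1)) * hi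
    linear_combination -this + (D * x - 1 - m * xr - d * xr + m * x - y) * h2
  have hor : ¬(xr = x ∧ yr = (ed d).toAffine.negY x y) := fun h => hrx h.1
  rw [Affine.Point.add_some hor, Affine.Point.some.injEq, hslope]
  have ex : xp = (ed d).toAffine.addX xr x (m + d + D) := by
    simp only [Affine.addX, ed]
    rw [← j1, exr]
    linear_combination (-(m * d) - m * D - d ^ 2 - d * D ) * h2
  refine ⟨ex, ?_⟩
  have ey : (ed d).toAffine.addY xr x yr (m + d + D) =
      -((m + d + D) * (xp - xr) + yr) - d * xp - 1 := by
    rw [ex]; simp only [Affine.addY, Affine.negAddY, Affine.negY, ed]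
  rw [ey, eyr, ← j2, ← j1]
  have hDm : D * m = δ * σ₀ ^ 2 * σ₁ * k * s₂ := by
    rw [hD, hm]; linear_combination (δ * σ₀ ^ 2 * k * s₂ * σ₁) * hi
  rw [← hDm]
  have h2x : ∀ t : L, t + t = 0 := fun t => by linear_combination t * h2
  clear_value xr yr
  have hDx : D * (xr + x) = d * x + 1 := by
      rw [hX, i3, hD]
      linear_combination (δ * σ₀ ^ 3 * i ^ 2 * x) * hk + (δ * σ₀ * x * (σ₀ * i + 1)) * hi
  rw [← i3]
  clear * - h2 hDx
  grind
end ch2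
end WMW

set_option linter.unusedSectionVars false
set_option linter.style.haveILetI false
set_option linter.unusedVariables false
namespace WMW
open WeierstrassCurve

lemma val_three {L : Type*} [Field L] (v : Valuation L (WithZero (Multiplicative ℤ)))
    {A B X Y : L} (hA : v A ≤ 1) (hB : v B = 1) (hY : Y ≠ 0) (h : Y ^ 2 + A * X * Y + B * Y = X ^ 3) :
    ∃ w, v Y = w ^ 3 := by
  have h0 : v Y ≠ 0 := (v.ne_zero_iff).2 hY
  have hv : v Y * v (Y + A * X + B) = v X ^ 3 := by rw [← map_pow, ← h, ← map_mul]; congr 1; ring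
  have hAX : v (A * X) ≤ v X := by rw [map_mul]; exact mul_le_of_le_one_left' hA
  rcases lt_trichotomy (v Y) 1 with h1 | h1 | h1
  · have hX : v X < 1 := by
      by_contra! hX
      have : v (Y + A * X + B) ≤ v X :=
        v.map_add_le (v.map_add_le (h1.le.trans hX) hAX) (hB.le.trans hX)
      have h3 : v Y * v (Y + A * X + B) < 1 * v X :=
        by
          have hX0 : 0 < v X := lt_of_lt_of_le zero_lt_one hX
          calc v Y * v (Y + A * X + B) ≤ v Y * v X := mul_le_mul_right this _
            _ < 1 * v X := mul_lt_mul_of_pos_right h1 hX0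
      rw [hv, one_mul] at h3
      have : v X ≤ v X ^ 3 := le_self_pow₀ hX (by norm_num)
      exact absurd h3 this.not_gt
    have : v (Y + A * X + B) = 1 := by
      rw [v.map_add_eq_of_lt_right, hB]
      rw [hB]; exact v.map_add_lt h1 (hAX.trans_lt hX)
    rw [this, mul_one] at hv
    exact ⟨_, hv⟩
  · exact ⟨1, by simpa using h1⟩
  · have hX : v X < v Y := by
      by_contra! hX
      have : v (Y + A * X + B) ≤ v X :=
        v.map_add_le (v.map_add_le hX hAX) (hB.le.trans (h1.le.trans hX))
      have h3 : v X ^ 3 ≤ v X * v X := by rw [← hv]; exact mul_le_mul' hX this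
      have h4 : v X * v X < v X ^ 3 := by
        have : 1 < v X := h1.trans_le hX
        calc v X * v X = v X ^ 2 := (pow_two _).symm
          _ < v X ^ 3 := pow_lt_pow_right₀ this (by norm_num)
      exact absurd h4 h3.not_gt
    have : v (Y + A * X + B) = v Y := by
      have e : v (Y + A * X) = v Y := v.map_add_eq_of_lt_left (hAX.trans_lt hX)
      rw [v.map_add_eq_of_lt_left, e]
      rw [hB, e]; exact h1
    rw [this] at hv
    refine ⟨v Y / v X, ?_⟩
    rw [div_pow, ← hv]
    field_simp

section ch2
variable {L : Type*} [Field L] [DecidableEq L]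

lemma fin_x (W : WeierstrassCurve L) (x₀ : L) :
    {P : W.toAffine.Point | ∃ y h, P = .some x₀ y h}.Finite := by
  by_cases hy : ∃ y, W.toAffine.Nonsingular x₀ y
  · obtain ⟨y₀, h₀⟩ := hy
    refine Set.Finite.subset (s := {.some x₀ y₀ h₀, -.some x₀ y₀ h₀}) (by simp) ?_
    rintro P ⟨y, h, rfl⟩
    rw [Affine.Point.neg_some]
    rcases Affine.Y_eq_of_X_eq h.1 h₀.1 rfl with rfl | rfl
    · simp
    · simp
  · convert Set.finite_empty
    ext P
    simp only [Set.mem_empty_iff_false, iff_false]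
    rintro ⟨y, h, rfl⟩
    exact hy ⟨y, h⟩

lemma kum (W : WeierstrassCurve L) {s t r : L}
    (hf : ∀ X, X ^ 3 + W.a₂ * X ^ 2 + W.a₄ * X + W.a₆ -
      ((s * X + t) ^ 2 + W.a₁ * X * (s * X + t) + W.a₃ * (s * X + t)) = (X - r) ^ 3)
    {x₁ y₁ x₂ y₂ x₃ y₃ : L} (h₁ : W.toAffine.Equation x₁ y₁)
    (h₂ : W.toAffine.Equation x₂ y₂)
    (hxy : ¬(x₁ = x₂ ∧ y₁ = W.toAffine.negY x₂ (W.toAffine.negY x₂ y₂)))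
    (hx₃ : x₃ = W.toAffine.addX x₁ x₂ (W.toAffine.slope x₁ x₂ y₁ (W.toAffine.negY x₂ y₂)))
    (hy₃ : y₃ = W.toAffine.addY x₁ x₂ y₁ (W.toAffine.slope x₁ x₂ y₁ (W.toAffine.negY x₂ y₂))) :
    ∃ κ, (y₁ - s * x₁ - t) * ((x₂ - r) * (x₃ - r)) ^ 3 =
      κ ^ 3 * ((y₂ - s * x₂ - t) * (y₃ - s * x₃ - t)) := by
  have neg : ∀ x y, W.toAffine.Equation x y →
      (y - s * x - t) * (W.toAffine.negY x y - s * x - t) = -(x - r) ^ 3 := by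
    intro x y h
    rw [Affine.equation_iff] at h
    rw [← hf, Affine.negY]
    linear_combination -h
  have h₂' : W.toAffine.Equation x₂ (W.toAffine.negY x₂ y₂) := (Affine.equation_neg ..).2 h₂
  have h₃ : W.toAffine.Equation x₃ y₃ := by
    rw [hx₃, hy₃]; exact Affine.equation_add h₁ h₂' hxy
  have n3 : W.toAffine.negY x₃ y₃ = W.toAffine.slope x₁ x₂ y₁ (W.toAffine.negY x₂ y₂) * (x₃ - x₁) + y₁ := by
    rw [hy₃, Affine.addY, ← hx₃, Affine.negY_negY, Affine.negAddY, ← hx₃]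
  have n2 : W.toAffine.negY x₂ y₂ = W.toAffine.slope x₁ x₂ y₁ (W.toAffine.negY x₂ y₂) * (x₂ - x₁) + y₁ := by
    by_cases hx : x₁ = x₂
    · have hy := Affine.Y_eq_of_Y_ne h₁ h₂' hx (fun h => hxy ⟨hx, h⟩)
      rw [← hy, hx]; ring
    · rw [Affine.slope_of_X_ne hx]
      have : x₁ - x₂ ≠ 0 := sub_ne_zero.2 hx
      field_simp
      ring
  have E2 := neg _ _ h₂
  have E3 := neg _ _ h₃
  have key : ∃ κ, (y₁ - s * x₁ - t) * (W.toAffine.negY x₂ y₂ - s * x₂ - t) *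
      (W.toAffine.negY x₃ y₃ - s * x₃ - t) = κ ^ 3 := by
    have P := Affine.addPolynomial_slope h₁ h₂' hxy
    rw [← hx₃] at P
    clear hy₃ hx₃ hxy
    generalize W.toAffine.slope x₁ x₂ y₁ (W.toAffine.negY x₂ y₂) = m at *
    rw [n3, n2]
    by_cases hm : m = s
    · exact ⟨y₁ - m * x₁ - t, by rw [hm]; ring⟩
    have hm' : m - s ≠ 0 := sub_ne_zero.2 hm
    obtain ⟨e, he⟩ : ∃ e, (m - s) * e = m * x₁ - y₁ + t := ⟨(m * x₁ - y₁ + t) / (m - s), by field_simp⟩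
    have P := congrArg (Polynomial.eval e) P
    rw [Affine.addPolynomial_eq] at P
    simp [Cubic.toPoly] at P
    have hl : m * (e - x₁) + y₁ = s * e + t := by linear_combination he
    have F := hf e
    rw [← hl] at F
    have Q : (e - x₁) * (e - x₂) * (e - x₃) = (e - r) ^ 3 := by
      rw [← F]; linear_combination P
    refine ⟨-((m - s) * (e - r)), ?_⟩
    have g1 : ∀ x, m * (x - x₁) + y₁ - s * x - t = -((m - s) * (e - x)) := by
      intro x; linear_combination he
    have g0 : y₁ - s * x₁ - t = -((m - s) * (e - x₁)) := by rw [← g1]; ring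
    rw [g1, g1, g0]
    linear_combination (-(m - s) ^ 3) * Q
  obtain ⟨κ, hκ⟩ := key
  refine ⟨κ, ?_⟩
  rw [← hκ]
  generalize W.toAffine.negY x₂ y₂ - s * x₂ - t = a at *
  generalize W.toAffine.negY x₃ y₃ - s * x₃ - t = b at *
  have : ((x₂ - r) * (x₃ - r)) ^ 3 = (-(x₂ - r) ^ 3) * (-(x₃ - r) ^ 3) := by ring
  rw [this, ← E2, ← E3]
  ring
end ch2
end WMW

set_option linter.unusedSectionVars false
set_option linter.style.haveILetI false
set_option linter.unusedVariables false
namespace WMW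
open WeierstrassCurve

section alg
variable {L : Type*} [Field L]
lemma prod_u (h2 : (2 : L) = 0) {ω : L} (hω : ω ^ 2 + ω + 1 = 0) {d δ z w : L}
    (hδ : δ ^ 3 = d ^ 3 + 1) (hH : w ^ 3 + z ^ 3 + 1 = d * z * w) :
    (d + z + w) * (d + ω * z + ω ^ 2 * w) * (d + ω ^ 2 * z + ω * w) = δ ^ 3 := by
  grind

set_option maxRecDepth 20000 in
lemma g_id (h2 : (2 : L) = 0) {ω : L} (hω : ω ^ 2 + ω + 1 = 0) {d δ z w : L}
    (hδ : δ ^ 3 = d ^ 3 + 1) (hH : w ^ 3 + z ^ 3 + 1 = d * z * w) :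
    ((d + δ) * (z ^ 3 + (δ + ω ^ 2 * d) * (z * w)) + ω ^ 2 * (δ + ω ^ 2 * d))
    * (d + z + w) * (d + ω * z + ω ^ 2 * w) ^ 2 =
    (d + δ) * ((d + z + w) * (d + ω * z + ω ^ 2 * w) + δ * (d + ω * z + ω ^ 2 * w) + δ ^ 2) ^ 3 := by
  grind

lemma hf_id (h2 : (2 : L) = 0) {ω : L} (hω : ω ^ 2 + ω + 1 = 0) {d δ r : L}
    (hδ : δ ^ 3 = d ^ 3 + 1) (hr : (d + δ) * r = 1) (X : L) :
    X ^ 3 - (((δ + ω ^ 2 * d) * X + ω ^ 2 * (δ + ω ^ 2 * d) * r) ^ 2 +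
      d * X * ((δ + ω ^ 2 * d) * X + ω ^ 2 * (δ + ω ^ 2 * d) * r) +
      ((δ + ω ^ 2 * d) * X + ω ^ 2 * (δ + ω ^ 2 * d) * r)) = (X - r) ^ 3 := by
  have c2 : (δ + ω ^ 2 * d) ^ 2 + d * (δ + ω ^ 2 * d) = r := by
    have : (δ ^ 2 + d * δ + d ^ 2) * (d + δ) = 1 := by grind
    have : δ ^ 2 + d * δ + d ^ 2 = r := by
      have h0 : d + δ ≠ 0 := by rintro h; rw [h] at hr; simp at hr
      apply mul_right_cancel₀ h0; rw [this, ← hr]; ring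
    grind
  have c1 : d * (ω ^ 2 * (δ + ω ^ 2 * d) * r) + (δ + ω ^ 2 * d) = r ^ 2 := by grind
  have c0 : (ω ^ 2 * (δ + ω ^ 2 * d) * r) ^ 2 + ω ^ 2 * (δ + ω ^ 2 * d) * r = r ^ 3 := by grind
  generalize ω ^ 2 * (δ + ω ^ 2 * d) * r = t at *
  generalize (δ + ω ^ 2 * d) = s at *
  clear hω hδ hr
  grind

lemma s012 (h2 : (2 : L) = 0) {ω : L} (hω : ω ^ 2 + ω + 1 = 0) (d z w : L) :
    (d + z + w) + (d + ω * z + ω ^ 2 * w) + (d + ω ^ 2 * z + ω * w) = d ∧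
    (d + z + w) + ω ^ 2 * (d + ω * z + ω ^ 2 * w) + ω * (d + ω ^ 2 * z + ω * w) = z ∧
    (d + z + w) + ω * (d + ω * z + ω ^ 2 * w) + ω ^ 2 * (d + ω ^ 2 * z + ω * w) = w := by
  refine ⟨?_, ?_, ?_⟩ <;> grind

/-- from cube root data to `b, c, k` -/
lemma bck (h2 : (2 : L) = 0) {ω : L} (hω : ω ^ 2 + ω + 1 = 0) {d δ r x y z γ : L}
    (hδ : δ ^ 3 = d ^ 3 + 1) (hδ0 : δ ≠ 0) (hr : (d + δ) * r = 1) (hz : y = z ^ 3) (hz0 : z ≠ 0)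
    (hE : y ^ 2 + d * x * y + y = x ^ 3) (hdx : d * x + 1 ≠ 0)
    (hg : y - (δ + ω ^ 2 * d) * x - ω ^ 2 * (δ + ω ^ 2 * d) * r = γ ^ 3) (hγ : γ ≠ 0) :
    ∃ b c k, d = δ * (1 + b ^ 3 + c ^ 3) * k ∧ b * c * k = 1 ∧ b + c ≠ 0 ∧
      x = δ ^ 2 * k ^ 2 * (1 + ω ^ 2 * b ^ 3 + ω * c ^ 3) * (1 + ω * b ^ 3 + ω ^ 2 * c ^ 3) ∧
      y = δ ^ 3 * k ^ 3 * (1 + ω ^ 2 * b ^ 3 + ω * c ^ 3) ^ 3 := by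
  obtain ⟨w, hw⟩ : ∃ w, x = z * w := ⟨x / z, by field_simp⟩
  have hH : w ^ 3 + z ^ 3 + 1 = d * z * w := by
    have : z ^ 3 * (w ^ 3 + z ^ 3 + 1 - d * z * w) = 0 := by
      rw [hz, hw] at hE
      linear_combination hE + z ^ 3 * (w ^ 3 - d * z * w) * h2
    rcases mul_eq_zero.1 this with h | h
    · exact absurd h (pow_ne_zero _ hz0)
    · linear_combination h
  have hp := prod_u h2 hω hδ hH
  have hg' := g_id h2 hω hδ hH
  have e0 : (d + δ) * γ ^ 3 = ((d + δ) * (z ^ 3 + (δ + ω ^ 2 * d) * (z * w)) + ω ^ 2 * (δ + ω ^ 2 * d)) := by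
    rw [← hg, hz, hw]
    linear_combination (-ω ^ 2 * (δ + ω ^ 2 * d)) * hr - ((d + δ) * ((δ + ω ^ 2 * d) * (z * w)) + ω ^ 2 * (δ + ω ^ 2 * d)) * h2
  rw [← e0] at hg'
  have h0 : d + δ ≠ 0 := by rintro h; rw [h] at hr; simp at hr
  have hg2 : γ ^ 3 * (d + z + w) * (d + ω * z + ω ^ 2 * w) ^ 2 =
    ((d + z + w) * (d + ω * z + ω ^ 2 * w) + δ * (d + ω * z + ω ^ 2 * w) + δ ^ 2) ^ 3 := by
    apply mul_left_cancel₀ h0; rw [← hg']; ring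
  have hw0 : z ≠ w := by
    rintro rfl
    apply hdx
    rw [hw]
    grind
  obtain ⟨s0, s1, s2⟩ := s012 h2 hω d z w
  generalize d + z + w = u0 at *
  generalize d + ω * z + ω ^ 2 * w = u1 at *
  generalize d + ω ^ 2 * z + ω * w = u2 at *
  generalize u0 * u1 + δ * u1 + δ ^ 2 = q at *
  have n : u0 * u1 * u2 ≠ 0 := by rw [hp]; positivity
  have n0 : u0 ≠ 0 := by rintro rfl; simp at n
  have n1 : u1 ≠ 0 := by rintro rfl; simp at n
  have n2 : u2 ≠ 0 := by rintro rfl; simp at n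
  have nq : q ≠ 0 := by
    rintro rfl
    have : γ ^ 3 * u0 * u1 ^ 2 ≠ 0 := by positivity
    apply this; rw [hg2]; ring
  have hb0 : u1 * γ / q ≠ 0 := by positivity
  have hb : u0 * (u1 * γ / q) ^ 3 = u1 := by
    rw [div_pow, ← hg2]; field_simp
  generalize u1 * γ / q = b at *
  have hc0 : δ / (u0 * b) ≠ 0 := by positivity
  have hc : u0 * (δ / (u0 * b)) ^ 3 = u2 := by
    rw [div_pow, ← hp]
    have : (u0 * b) ^ 3 = u0 ^ 2 * u1 := by rw [← hb]; ring
    rw [this]; field_simp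
  have hk : u0 * (b * (δ / (u0 * b))) = δ := by field_simp
  generalize δ / (u0 * b) = c at *
  have hk' : u0 = δ * (1 / (b * c)) := by rw [← hk]; field_simp
  have hbk : b * c * (1 / (b * c)) = 1 := by field_simp
  refine ⟨b, c, 1 / (b * c), ?_, hbk, ?_, ?_, ?_⟩
  · rw [← s0, ← hb, ← hc, hk']; ring
  · intro h
    have : b = c := by linear_combination h - c * h2
    apply hw0
    rw [← s1, ← s2, ← hb, ← hc, this]; ring
  · rw [hw, ← s1, ← s2, ← hb, ← hc, hk']; ring
  · rw [hz, ← s1, ← hb, ← hc, hk']; ring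
end alg
end WMW

set_option linter.unusedSectionVars false
set_option linter.style.haveILetI false
set_option linter.unusedVariables false
namespace WMW
open WeierstrassCurve

section edfin
variable {L : Type*} [Field L] [DecidableEq L]

/-- one Kummer function -/
lemma one_kum {I : Type*} (v : I → Valuation L (WithZero (Multiplicative ℤ)))
    (h2 : (2 : L) = 0) {d s t r : L} (hB : d * r + 1 ≠ 0)
    (hf : ∀ X : L, X ^ 3 - ((s * X + t) ^ 2 + d * X * (s * X + t) + (s * X + t)) = (X - r) ^ 3)
    {n : ℕ} {f : L → Option (Fin n)} {T : Finset L} (hdT : d ∈ T) (hBT : d * r + 1 ∈ T)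
    (H : ∀ x y : L, x ≠ 0 → y ≠ 0 → (∀ i, (∀ a ∈ T, a ≠ 0 → v i a = 1) → ∃ w, v i x = w ^ 3) →
      (∀ i, (∀ a ∈ T, a ≠ 0 → v i a = 1) → ∃ w, v i y = w ^ 3) → f x = f y → ∃ z, x = y * z ^ 3)
    {x₁ y₁ x₂ y₂ x₃ y₃ : L} (h₁ : (ed d).toAffine.Equation x₁ y₁)
    (h₂ : (ed d).toAffine.Equation x₂ y₂)
    (hxy : ¬(x₁ = x₂ ∧ y₁ = (ed d).toAffine.negY x₂ ((ed d).toAffine.negY x₂ y₂)))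
    (hx₃ : x₃ = (ed d).toAffine.addX x₁ x₂ ((ed d).toAffine.slope x₁ x₂ y₁ ((ed d).toAffine.negY x₂ y₂)))
    (hy₃ : y₃ = (ed d).toAffine.addY x₁ x₂ y₁ ((ed d).toAffine.slope x₁ x₂ y₁ ((ed d).toAffine.negY x₂ y₂)))
    (r₁ : x₁ ≠ r) (r₂ : x₂ ≠ r) (r₃ : x₃ ≠ r)
    (hc : f (y₁ - s * x₁ - t) = f (y₂ - s * x₂ - t)) :
    ∃ z, y₃ - s * x₃ - t = z ^ 3 ∧ z ≠ 0 := by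
  have eqY : ∀ x y, (ed d).toAffine.Equation x y →
      (y - s * x - t) ^ 2 + d * (x - r) * (y - s * x - t) + (d * r + 1) * (y - s * x - t) = (x - r) ^ 3 := by
    intro x y h
    rw [ed_eq] at h
    rw [← hf x]
    linear_combination h - (s * x + t) * (y - s * x - t) * h2 - ((s * x + t) ^ 2 + d * x * (s * x + t) + (s * x + t)) * h2 + ((s * x + t) ^ 2 + d * x * (s * x + t) + (s * x + t)) * h2
  have ne : ∀ x y, (ed d).toAffine.Equation x y → x ≠ r → y - s * x - t ≠ 0 := by
    intro x y h hx h0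
    have := eqY x y h
    rw [h0] at this
    have h3 : (x - r) ^ 3 ≠ 0 := pow_ne_zero _ (sub_ne_zero.2 hx)
    apply h3; rw [← this]; ring
  have vals : ∀ x y, (ed d).toAffine.Equation x y → x ≠ r →
      ∀ i, (∀ a ∈ T, a ≠ 0 → v i a = 1) → ∃ w, v i (y - s * x - t) = w ^ 3 := by
    intro x y h hx i hi
    refine val_three (v i) ?_ (hi _ hBT hB) (ne x y h hx) (eqY x y h)
    by_cases hd : d = 0
    · rw [hd]; simp
    · exact (hi _ hdT hd).le
  obtain ⟨κ, hκ⟩ := kum (ed d) (s := s) (t := t) (r := r) (fun X => by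
    rw [← hf X]; simp only [ed]; ring) h₁ h₂ hxy hx₃ hy₃
  obtain ⟨z, hz⟩ := H _ _ (ne _ _ h₁ r₁) (ne _ _ h₂ r₂) (vals _ _ h₁ r₁) (vals _ _ h₂ r₂) hc
  have g1 := ne _ _ h₁ r₁
  have g2 := ne _ _ h₂ r₂
  have r₂' := sub_ne_zero.2 r₂
  have r₃' := sub_ne_zero.2 r₃
  have hz0 : z ≠ 0 := by rintro rfl; apply g1; rw [hz]; ring
  have hk0 : κ ≠ 0 := by
    rintro rfl
    have : (y₁ - s * x₁ - t) * ((x₂ - r) * (x₃ - r)) ^ 3 ≠ 0 := by positivity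
    apply this; rw [hκ]; ring
  refine ⟨z * ((x₂ - r) * (x₃ - r)) / κ, ?_, by positivity⟩
  rw [div_pow, eq_div_iff (by positivity)]
  apply mul_left_cancel₀ g2
  rw [hz] at hκ
  linear_combination -hκ

theorem ed_fin {I : Type*} (v : I → Valuation L (WithZero (Multiplicative ℤ))) (hv : HasSel v 3)
    (h2 : (2 : L) = 0) {ω : L} (hω : ω ^ 2 + ω + 1 = 0) {d δ : L}
    (hδ : δ ^ 3 = d ^ 3 + 1) (hδ0 : δ ≠ 0) [(ed d).IsElliptic] :
    (nsmulAddMonoidHom (α := (ed d).toAffine.Point) 3).range.FiniteIndex := by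
  have hD : d + δ ≠ 0 := by
    intro h
    have : δ = -d := by linear_combination h
    rw [this] at hδ
    have : (1 : L) = 0 := by linear_combination -hδ - d ^ 3 * h2
    exact one_ne_zero this
  obtain ⟨r, hr⟩ : ∃ r, (d + δ) * r = 1 := ⟨1 / (d + δ), by field_simp⟩
  have hB : d * r + 1 ≠ 0 := by
    intro h
    have : δ = 0 := by linear_combination (d + δ) * h - d * hr - d * h2
    exact hδ0 this
  obtain ⟨n, f, hf⟩ := hv {d, d * r + 1, 1}
  set s := δ + ω ^ 2 * d with hs
  set t := ω ^ 2 * s * r with ht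
  let c : (ed d).toAffine.Point → Option (Fin n) × Option (Fin n) := fun P =>
    match P with
    | 0 => (none, none)
    | .some x y h => (f (y - 0 * x - 0), f (y - s * x - t))
  let S : L → Set (ed d).toAffine.Point := fun x₀ => {P | ∃ y h, P = .some x₀ y h}
  let Z : Set (ed d).toAffine.Point := {0} ∪ (S 0 ∪ (S r ∪ S (1 / d)))
  have hZ : Z.Finite := (Set.finite_singleton 0).union
    ((fin_x _ _).union ((fin_x _ _).union (fin_x _ _)))
  have good : ∀ x y h, Affine.Point.some x y h ∉ Z → x ≠ 0 ∧ x ≠ r ∧ d * x + 1 ≠ 0 := by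
    intro x y h hz
    refine ⟨?_, ?_, ?_⟩
    · rintro rfl; exact hz (.inr (.inl ⟨y, h, rfl⟩))
    · rintro rfl; exact hz (.inr (.inr (.inl ⟨y, h, rfl⟩)))
    · intro h0
      have hd : d ≠ 0 := by rintro rfl; simp at h0
      have : x = 1 / d := by
        rw [eq_div_iff hd]; linear_combination h0 - h2
      subst this
      exact hz (.inr (.inr (.inr ⟨y, h, rfl⟩)))
  refine coset_fin 3 Z hZ c ?_
  intro P Q hP hQ hc hPQ
  cases P with
  | zero => exact absurd (by simp [Z, Affine.Point.zero_def]) hP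
  | some x₁ y₁ k₁ =>
  cases Q with
  | zero => exact absurd (by simp [Z, Affine.Point.zero_def]) hQ
  | some x₂ y₂ k₂ =>
  rw [sub_eq_add_neg, Affine.Point.neg_some] at hPQ ⊢
  have k₂' := (Affine.nonsingular_neg x₂ y₂).2 k₂
  by_cases hxy : x₁ = x₂ ∧ y₁ = (ed d).toAffine.negY x₂ ((ed d).toAffine.negY x₂ y₂)
  · rw [Affine.Point.add_of_Y_eq hxy.1 hxy.2]
    exact ⟨0, by simp⟩
  rw [Affine.Point.add_some hxy] at hPQ ⊢
  obtain ⟨g1, g2, g3⟩ := good _ _ _ hPQ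
  obtain ⟨p1, p2, p3⟩ := good _ _ _ hP
  obtain ⟨q1, q2, q3⟩ := good _ _ _ hQ
  simp only [c, Prod.mk.injEq] at hc
  have hns := Affine.nonsingular_add k₁ k₂' hxy
  obtain ⟨z, hz, hz0⟩ := one_kum v h2 (d := d) (s := 0) (t := 0) (r := 0) (by simp) (by intro X; ring)
    (T := {d, d * r + 1, 1}) (by simp) (by simp) hf k₁.1 k₂.1 hxy rfl rfl p1 q1 g1 hc.1
  obtain ⟨γ, hγ, hγ0⟩ := one_kum v h2 (d := d) (s := s) (t := t) (r := r) hB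
    (hf_id h2 hω hδ hr)
    (T := {d, d * r + 1, 1}) (by simp) (by simp) hf k₁.1 k₂.1 hxy rfl rfl p2 q2 g2 hc.2
  obtain ⟨b, c', k, b1, b2, b3, b4, b5⟩ := bck h2 hω hδ hδ0 hr (z := z) (by rw [← hz]; ring) hz0
    ((ed_eq ..).1 hns.1) g3 hγ hγ0
  exact trisect h2 hω hδ hδ0 b1 b2 b3 hns b4 b5
end edfin
end WMW

set_option linter.unusedSectionVars false
set_option linter.style.haveILetI false
set_option linter.unusedVariables false
namespace WMW
open Algebra Polynomial IsDedekindDomain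

lemma sep_alg (Fq L : Type*) [Field Fq] [Finite Fq] [Field L] [Algebra (RatFunc Fq) L]
    [FiniteDimensional (RatFunc Fq) L] :
    ∃ (_ : Algebra (RatFunc Fq) L), FiniteDimensional (RatFunc Fq) L ∧
      Algebra.IsSeparable (RatFunc Fq) L := by
  letI : Algebra Fq[X] L := ((algebraMap (RatFunc Fq) L).comp (algebraMap Fq[X] (RatFunc Fq))).toAlgebra
  haveI : IsScalarTower Fq[X] (RatFunc Fq) L := IsScalarTower.of_algebraMap_eq fun _ => rfl
  letI : Algebra Fq L := ((algebraMap (RatFunc Fq) L).comp (algebraMap Fq (RatFunc Fq))).toAlgebra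
  haveI : IsScalarTower Fq (RatFunc Fq) L := IsScalarTower.of_algebraMap_eq fun _ => rfl
  haveI : IsScalarTower Fq Fq[X] L := IsScalarTower.of_algebraMap_eq fun x => by
    rw [IsScalarTower.algebraMap_apply Fq (RatFunc Fq) L, IsScalarTower.algebraMap_apply Fq[X] (RatFunc Fq) L,
      ← IsScalarTower.algebraMap_apply Fq Fq[X] (RatFunc Fq)]
  haveI : Algebra.EssFiniteType Fq[X] (RatFunc Fq) := .of_isLocalization _ (nonZeroDivisors Fq[X])
  haveI : Algebra.EssFiniteType Fq (RatFunc Fq) := .comp Fq Fq[X] (RatFunc Fq)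
  haveI : Algebra.EssFiniteType Fq L := .comp Fq (RatFunc Fq) L
  obtain ⟨s, hs, hsep⟩ := exists_isTranscendenceBasis_and_isSeparable_of_perfectField Fq L
  haveI : FaithfulSMul Fq[X] L := by
    rw [faithfulSMul_iff_algebraMap_injective, IsScalarTower.algebraMap_eq Fq[X] (RatFunc Fq) L]
    exact (algebraMap (RatFunc Fq) L).injective.comp (IsFractionRing.injective _ _)
  have halg : Algebra.IsAlgebraic Fq[X] L := by
    have := Algebra.IsAlgebraic.of_finite (RatFunc Fq) L
    exact (IsFractionRing.comap_isAlgebraic_iff (A := Fq[X]) (K := RatFunc Fq) (C := L)).2 this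
  have htd : Algebra.trdeg Fq L = 1 := by
    have := lift_trdeg_add_eq Fq Fq[X] L
    rw [trdeg_eq_zero (R := Fq[X]) (A := L), Polynomial.trdeg_of_isDomain] at this
    simpa using this.symm
  have hcard := hs.cardinalMk_eq_trdeg
  rw [htd] at hcard
  have hc : s.card = 1 := by
    simpa using hcard
  obtain ⟨t, rfl⟩ := Finset.card_eq_one.1 hc
  have ht : Transcendental Fq t := hs.1.transcendental ⟨t, by simp⟩
  rw [Finset.coe_singleton] at hsep
  let e := RatFunc.algEquivOfTranscendental t ht
  letI A : Algebra (RatFunc Fq) L := ((algebraMap (IntermediateField.adjoin Fq {t}) L).comp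
    (e : RatFunc Fq →+* _)).toAlgebra
  haveI : Algebra.EssFiniteType (IntermediateField.adjoin Fq {t}) L := .of_comp Fq _ _
  haveI : FiniteDimensional (IntermediateField.adjoin Fq {t}) L :=
    Algebra.finite_of_essFiniteType_of_isAlgebraic
  refine ⟨A, ?_, ?_⟩
  · exact Module.Finite.of_equiv_equiv (A₁ := IntermediateField.adjoin Fq {t}) (B₁ := L)
      e.symm.toRingEquiv (RingEquiv.refl L) (by
        ext x; simp [A, RingHom.algebraMap_toAlgebra])
  · exact Algebra.IsSeparable.of_equiv_equiv (A₁ := IntermediateField.adjoin Fq {t}) (B₁ := L)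
      e.symm.toRingEquiv (RingEquiv.refl L) (by
        ext x; simp [A, RingHom.algebraMap_toAlgebra])

lemma arith.{u1, u2} (Fq : Type u1) (L : Type u2) [Field Fq] [Finite Fq] [Field L] [Algebra (RatFunc Fq) L]
    [FiniteDimensional (RatFunc Fq) L] :
    ∃ (I : Type u2) (v : I → Valuation L (WithZero (Multiplicative ℤ))), (∀ m, m ≠ 0 → HasSel v m) ∧
      ∃ (_ : Height.AdmissibleAbsValues L), Northcott (Height.mulHeight₁ (K := L)) := by
  obtain ⟨A, h1, h2⟩ := sep_alg Fq L
  letI : Algebra Fq[X] L := ((algebraMap (RatFunc Fq) L).comp (algebraMap Fq[X] (RatFunc Fq))).toAlgebra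
  haveI : IsScalarTower Fq[X] (RatFunc Fq) L := IsScalarTower.of_algebraMap_eq fun _ => rfl
  haveI : FunctionField Fq L := h1
  obtain ⟨s, hs⟩ := exists_s Fq L
  obtain ⟨v⟩ := exists_hos Fq L
  haveI := fin_cl Fq L
  exact ⟨_, _, fun m hm => hasSel s hs v m hm, adm s hs, northcott s hs v⟩
end WMW

set_option linter.unusedSectionVars false
set_option linter.style.haveILetI false
set_option linter.unusedVariables false
namespace WMW
open WeierstrassCurve

lemma fg_inj {A B : Type*} [AddCommGroup A] [AddCommGroup B] (f : A →+ B)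
    (hf : Function.Injective f) (h : AddGroup.FG B) : AddGroup.FG A := by
  have : Module.Finite ℤ B := Module.Finite.iff_addGroup_fg.2 h
  have : Module.Finite ℤ A := Module.Finite.of_injective f.toIntLinearMap hf
  exact Module.Finite.iff_addGroup_fg.1 this

lemma descend {K L : Type*} [Field K] [DecidableEq K] [Field L] [DecidableEq L] [Algebra K L]
    (W : WeierstrassCurve K) [W.IsElliptic] (W' : WeierstrassCurve L) [W'.IsElliptic] {u r s t : L}
    (c : VC (W.map (algebraMap K L)) W' u r s t) (h : AddGroup.FG W'.toAffine.Point) :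
    AddGroup.FG W.toAffine.Point := by
  have h1 : AddGroup.FG (W.map (algebraMap K L)).toAffine.Point := by
    have := h
    exact AddGroup.fg_of_surjective c.surj
  let φ : W.toAffine.Point →+ (W.map (algebraMap K L)).toAffine.Point :=
    Affine.Point.map (W' := W.toAffine) (F := K) (K := L) (Algebra.ofId K L)
  exact fg_inj φ (Affine.Point.map_injective (W' := W.toAffine) (F := K) (K := L) (Algebra.ofId K L)) h1

lemma VC.of_map {K L : Type*} [Field K] [Field L] (φ : K →+* L) {W W' : WeierstrassCurve K}
    {u r s t : K} (c : VC (W.map φ) (W'.map φ) (φ u) (φ r) (φ s) (φ t)) : VC W W' u r s t := by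
  obtain ⟨hu, h1, h2, h3, h4, h6⟩ := c
  simp only [map_a₁, map_a₂, map_a₃, map_a₄, map_a₆] at h1 h2 h3 h4 h6
  refine ⟨fun h => hu (by rw [h, map_zero]), ?_, ?_, ?_, ?_, ?_⟩ <;> apply φ.injective <;>
    simp only [map_mul, map_add, map_sub, map_pow, map_ofNat] <;> assumption

lemma vc_leg {L : Type*} [Field L] (h2 : (2 : L) ≠ 0) (W : WeierstrassCurve L) {e₁ e₂ e₃ : L}
    (hb : W.a₁ ^ 2 + 4 * W.a₂ = 4 * -(e₁ + e₂ + e₃))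
    (hc : 2 * (2 * W.a₄ + W.a₁ * W.a₃) = 4 * (e₁ * e₂ + e₁ * e₃ + e₂ * e₃))
    (hd : W.a₃ ^ 2 + 4 * W.a₆ = 4 * -(e₁ * e₂ * e₃)) :
    VC W (leg e₁ e₂ e₃) 1 0 (-(W.a₁ / 2)) (-(W.a₃ / 2)) := by
  have h4 : (4 : L) ≠ 0 := by
    have : (4 : L) = 2 * 2 := by norm_num
    rw [this]; exact mul_ne_zero h2 h2
  obtain ⟨x, hx⟩ : ∃ x, W.a₁ = 2 * x := ⟨W.a₁ / 2, by field_simp⟩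
  obtain ⟨y, hy⟩ : ∃ y, W.a₃ = 2 * y := ⟨W.a₃ / 2, by field_simp⟩
  have hx' : W.a₁ / 2 = x := by rw [hx]; field_simp
  have hy' : W.a₃ / 2 = y := by rw [hy]; field_simp
  rw [hx', hy']
  constructor
  · exact one_ne_zero
  · simp only [leg, hx, hy]; ring
  · simp only [leg, hx, hy] at *; apply mul_left_cancel₀ h4; linear_combination -hb
  · simp only [leg, hx, hy]; ring
  · simp only [leg, hx, hy] at *; apply mul_left_cancel₀ h4; linear_combination -hc
  · simp only [leg, hx, hy] at *; apply mul_left_cancel₀ h4; linear_combination -hd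

lemma leg_ell {L : Type*} [Field L] (h2 : (2 : L) ≠ 0) {e₁ e₂ e₃ : L}
    (h12 : e₁ ≠ e₂) (h13 : e₁ ≠ e₃) (h23 : e₂ ≠ e₃) : (leg e₁ e₂ e₃).IsElliptic := by
  constructor
  apply Ne.isUnit
  have : (leg e₁ e₂ e₃).Δ = 2 ^ 4 * ((e₁ - e₂) * (e₁ - e₃) * (e₂ - e₃)) ^ 2 := by
    simp only [leg, Δ, b₂, b₄, b₆, b₈]; ring
  rw [this]
  exact mul_ne_zero (pow_ne_zero _ h2) (pow_ne_zero _ (mul_ne_zero (mul_ne_zero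
    (sub_ne_zero.2 h12) (sub_ne_zero.2 h13)) (sub_ne_zero.2 h23)))

lemma ed_delta {L : Type*} [Field L] (h2 : (2 : L) = 0) (d : L) : (ed d).Δ = d ^ 3 + 1 := by
  simp only [ed, Δ, b₂, b₄, b₆, b₈]; linear_combination (-14) * h2

lemma ed_j {L : Type*} [Field L] (h2 : (2 : L) = 0) (d : L) [(ed d).IsElliptic] :
    (ed d).j = d ^ 12 / (d ^ 3 + 1) := by
  rw [j, Units.val_inv_eq_inv_val, coe_Δ', ed_delta h2]
  have : (ed d).c₄ = d ^ 4 := by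
    simp only [ed, c₄, b₂, b₄]; linear_combination (-12 * d) * h2
  rw [this, div_eq_mul_inv]; ring

lemma ex_d {B : Type*} [Field B] [IsAlgClosed B] (J : B) : ∃ d : B, d ^ 12 = J * (d ^ 3 + 1) := by
  obtain ⟨d, hd⟩ := IsAlgClosed.exists_root
    (Polynomial.X ^ 12 - Polynomial.C J * (Polynomial.X ^ 3 + 1) : Polynomial B) (by
      have : (Polynomial.X ^ 12 - Polynomial.C J * (Polynomial.X ^ 3 + 1) :
        Polynomial B).degree = 12 := by
        compute_degree!
      rw [this]; norm_num)
  refine ⟨d, ?_⟩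
  simp [Polynomial.IsRoot] at hd
  linear_combination hd

section

lemma leg_fg (Fq : Type*) {K : Type*} [Field Fq] [Finite Fq] [Field K] [DecidableEq K]
    [Algebra (RatFunc Fq) K] [FiniteDimensional (RatFunc Fq) K] 
    (h2 : (2 : K) ≠ 0) {e₁ e₂ e₃ : K} [(leg e₁ e₂ e₃).IsElliptic]
    (h12 : e₁ ≠ e₂) (h13 : e₁ ≠ e₃) (h23 : e₂ ≠ e₃) :
    AddGroup.FG (leg e₁ e₂ e₃).toAffine.Point := by
  obtain ⟨I, v, hv, i1, i2⟩ := arith Fq K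
  exact fg_two _ (leg_fin v (hv 2 (by norm_num)) h2 h12 h13 h23)

lemma ed_fg (Fq : Type*) {K : Type*} [Field Fq] [Finite Fq] [Field K] [DecidableEq K]
    [Algebra (RatFunc Fq) K] [FiniteDimensional (RatFunc Fq) K] 
    (h2 : (2 : K) = 0) {ω : K} (hω : ω ^ 2 + ω + 1 = 0) {d δ : K}
    (hδ : δ ^ 3 = d ^ 3 + 1) (hδ0 : δ ≠ 0) [(ed d).IsElliptic] :
    AddGroup.FG (ed d).toAffine.Point := by
  obtain ⟨I, v, hv, i1, i2⟩ := arith Fq K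
  exact fg_three _ (ed_fin v (hv 3 (by norm_num)) h2 hω hδ hδ0)

lemma leg_desc (Fq : Type*) {K L : Type*} [Field Fq] [Finite Fq] [Field K] [DecidableEq K]
    [Algebra (RatFunc Fq) K] [FiniteDimensional (RatFunc Fq) K] [Field L] [Algebra K L]
    [FiniteDimensional K L] (W : WeierstrassCurve K) [W.IsElliptic] (h2 : (2 : L) ≠ 0) {e₁ e₂ e₃ : L}
    (h12 : e₁ ≠ e₂) (h13 : e₁ ≠ e₃) (h23 : e₂ ≠ e₃) {u r s t : L}
    (c : VC (W.map (algebraMap K L)) (leg e₁ e₂ e₃) u r s t) : AddGroup.FG W.toAffine.Point := by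
  classical
  letI : Algebra (RatFunc Fq) L := ((algebraMap K L).comp (algebraMap (RatFunc Fq) K)).toAlgebra
  haveI : IsScalarTower (RatFunc Fq) K L := IsScalarTower.of_algebraMap_eq fun _ => rfl
  haveI : FiniteDimensional (RatFunc Fq) L := FiniteDimensional.trans (RatFunc Fq) K L
  haveI := leg_ell h2 h12 h13 h23
  exact descend W _ c (leg_fg Fq h2 h12 h13 h23)

lemma ed_desc (Fq : Type*) {K L : Type*} [Field Fq] [Finite Fq] [Field K] [DecidableEq K]
    [Algebra (RatFunc Fq) K] [FiniteDimensional (RatFunc Fq) K] [Field L] [Algebra K L]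
    [FiniteDimensional K L] (W : WeierstrassCurve K) [W.IsElliptic] (h2 : (2 : L) = 0)
    {ω : L} (hω : ω ^ 2 + ω + 1 = 0) {d δ : L}
    (hδ : δ ^ 3 = d ^ 3 + 1) (hδ0 : δ ≠ 0) {u r s t : L}
    (c : VC (W.map (algebraMap K L)) (ed d) u r s t) : AddGroup.FG W.toAffine.Point := by
  classical
  letI : Algebra (RatFunc Fq) L := ((algebraMap K L).comp (algebraMap (RatFunc Fq) K)).toAlgebra
  haveI : IsScalarTower (RatFunc Fq) K L := IsScalarTower.of_algebraMap_eq fun _ => rfl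
  haveI : FiniteDimensional (RatFunc Fq) L := FiniteDimensional.trans (RatFunc Fq) K L
  haveI : (ed d).IsElliptic := by
    constructor
    apply Ne.isUnit
    rw [ed_delta h2, ← hδ]; exact pow_ne_zero _ hδ0
  exact descend W _ c (ed_fg Fq h2 hω hδ hδ0)

lemma mw_odd (Fq : Type*) {K : Type*} [Field Fq] [Finite Fq] [Field K] [DecidableEq K]
    [Algebra (RatFunc Fq) K] [FiniteDimensional (RatFunc Fq) K] 
    (h2 : (2 : K) ≠ 0) (W : WeierstrassCurve K) [W.IsElliptic] :
    AddGroup.FG W.toAffine.Point := by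
  classical
  let L := W.twoTorsionPolynomial.toPoly.SplittingField
  let φ := algebraMap K L
  have h4 : (4 : K) ≠ 0 := by
    have : (4 : K) = 2 * 2 := by norm_num
    rw [this]; exact mul_ne_zero h2 h2
  have h2L : (2 : L) ≠ 0 := by
    have := (map_ne_zero φ).2 h2
    rwa [map_ofNat] at this
  have ha : W.twoTorsionPolynomial.a ≠ 0 := h4
  obtain ⟨e₁, e₂, e₃, he⟩ := (Cubic.splits_iff_roots_eq_three (φ := φ) ha).1
    (Polynomial.SplittingField.splits _)
  have hd := W.twoTorsionPolynomial_discr_ne_zero_of_isElliptic (Ne.isUnit h2)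
  obtain ⟨h12, h13, h23⟩ := (Cubic.discr_ne_zero_iff_roots_ne ha he).1 hd
  have hb := Cubic.b_eq_three_roots ha he
  have hc := Cubic.c_eq_three_roots ha he
  have hdd := Cubic.d_eq_three_roots ha he
  simp only [twoTorsionPolynomial, b₂, b₄, b₆, map_add, map_mul, map_pow, map_ofNat] at hb hc hdd
  have c := vc_leg h2L (W.map φ) (e₁ := e₁) (e₂ := e₂) (e₃ := e₃) hb hc hdd
  exact leg_desc Fq W h2L h12 h13 h23 c

lemma mw_even (Fq : Type*) {K : Type*} [Field Fq] [Finite Fq] [Field K] [DecidableEq K]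
    [Algebra (RatFunc Fq) K] [FiniteDimensional (RatFunc Fq) K] 
    (h2 : (2 : K) = 0) (W : WeierstrassCurve K) [W.IsElliptic] :
    AddGroup.FG W.toAffine.Point := by
  classical
  let B := AlgebraicClosure K
  let ψ := algebraMap K B
  have h2B : (2 : B) = 0 := by rw [← map_ofNat ψ, h2, map_zero]
  obtain ⟨d, hd⟩ := ex_d (W.map ψ).j
  have hd1 : d ^ 3 + 1 ≠ 0 := by
    intro h
    rw [h, mul_zero] at hd
    have : d = 0 := by simpa using hd
    rw [this] at h; simp at h
  obtain ⟨δ, hδ⟩ := IsAlgClosed.exists_pow_nat_eq (d ^ 3 + 1) (n := 3) (by norm_num)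
  have hδ0 : δ ≠ 0 := by rintro rfl; apply hd1; rw [← hδ]; norm_num
  obtain ⟨ω, hω⟩ : ∃ ω : B, ω ^ 2 + ω + 1 = 0 := by
    obtain ⟨d, hd⟩ := IsAlgClosed.exists_root
      (Polynomial.X ^ 2 + Polynomial.X + 1 : Polynomial B) (by
        have : (Polynomial.X ^ 2 + Polynomial.X + 1 : Polynomial B).degree = 2 := by
          compute_degree!
        rw [this]; norm_num)
    refine ⟨d, ?_⟩
    simpa [Polynomial.IsRoot] using hd
  haveI : (ed d).IsElliptic := ⟨by rw [ed_delta h2B]; exact Ne.isUnit hd1⟩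
  have hj : (W.map ψ).j = (ed d).j := by
    rw [ed_j h2B, eq_div_iff hd1, hd]
  obtain ⟨C, hC⟩ := exists_variableChange_of_j_eq (W.map ψ) (ed d) hj
  have c := VC.of_smul (W.map ψ) C
  rw [hC] at c
  let S : Set B := {d, δ, ω, (C.u : B), C.r, C.s, C.t}
  let L := IntermediateField.adjoin K S
  haveI : FiniteDimensional K L := by
    haveI : Finite S := by
      apply Set.Finite.to_subtype; simp [S]
    exact IntermediateField.finiteDimensional_adjoin fun x _ => Algebra.IsIntegral.isIntegral x
  have lift : ∀ x ∈ S, ∃ y : L, algebraMap L B y = x := fun x hx =>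
    ⟨⟨x, IntermediateField.subset_adjoin K S hx⟩, rfl⟩
  obtain ⟨d', hde⟩ := lift d (by simp [S])
  obtain ⟨δ', hδe⟩ := lift δ (by simp [S])
  obtain ⟨ω', hωe⟩ := lift ω (by simp [S])
  obtain ⟨u', hu'⟩ := lift C.u (by simp [S])
  obtain ⟨r', hr'⟩ := lift C.r (by simp [S])
  obtain ⟨s', hs'⟩ := lift C.s (by simp [S])
  obtain ⟨t', ht'⟩ := lift C.t (by simp [S])
  have h2L : (2 : L) = 0 := by rw [← map_ofNat (algebraMap K L), h2, map_zero]
  have inj := (algebraMap L B).injective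
  have hω' : ω' ^ 2 + ω' + 1 = 0 := inj (by
    simp only [map_add, map_pow, map_one, map_zero, hωe]; exact hω)
  have hδ' : δ' ^ 3 = d' ^ 3 + 1 := inj (by
    simp only [map_add, map_pow, map_one, hδe, hde]; exact hδ)
  have hδ0' : δ' ≠ 0 := by rintro rfl; exact hδ0 (by rw [← hδe, map_zero])
  have hE : ed d = (ed d').map (algebraMap L B) := by
    rw [← hde]; simp [ed, WeierstrassCurve.map]
  have hW : W.map ψ = (W.map (algebraMap K L)).map (algebraMap L B) := by
    rw [WeierstrassCurve.map_map, ← IsScalarTower.algebraMap_eq]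
  rw [hE, hW, ← hu', ← hr', ← hs', ← ht'] at c
  have c' := VC.of_map _ c
  exact ed_desc Fq W h2L hω' hδ' hδ0' c'

lemma mw (Fq : Type*) {K : Type*} [Field Fq] [Finite Fq] [Field K] [DecidableEq K]
    [Algebra (RatFunc Fq) K] [FiniteDimensional (RatFunc Fq) K] 
    (W : WeierstrassCurve K) [W.IsElliptic] : AddGroup.FG W.toAffine.Point := by
  by_cases h2 : (2 : K) = 0
  · exact mw_even Fq h2 W
  · exact mw_odd Fq h2 W
end
end WMW

open Classical in
/-- **Weak Mordell–Weil for function fields**: if `K` is a function field over a finite field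
`Fq` of characteristic `p`, `E` is an elliptic curve over `K`, and `ℓ` is any prime number
(`ℓ = p` is allowed), then `E(K)/ℓE(K)` is finite. -/
theorem weak_mordell_weil
    (Fq K : Type*) [Field Fq] [Fintype Fq] [Field K] (p : ℕ) [CharP Fq p]
    [Algebra (RatFunc Fq) K] (hK : FunctionField Fq K)
    (W : WeierstrassCurve K) (hΔ : W.Δ ≠ 0)
    (ℓ : ℕ) (hℓ : ℓ.Prime) :
    Finite (W.toAffine.Point ⧸
      (DistribMulAction.toAddMonoidHom W.toAffine.Point (ℓ : ℤ)).range) := by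
  haveI : W.IsElliptic := ⟨Ne.isUnit hΔ⟩
  haveI : FiniteDimensional (RatFunc Fq) K := hK
  haveI := WMW.mw Fq W
  have h := WMW.fin_quot (A := W.toAffine.Point) ℓ hℓ.ne_zero
  have e : (DistribMulAction.toAddMonoidHom W.toAffine.Point (ℓ : ℤ)) =
      nsmulAddMonoidHom (α := W.toAffine.Point) ℓ := by
    ext P
    simp
  rw [e]
  exact h
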